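/- There exist constants c and C, depending only on the offspring law p, such that for all N ≥ 1 and all t ≥ 0: (i) sup_{ξ∈ℕ^N} ‖E[m(·, ξ^ξ_t)] − m(·,ξ)T_t‖ ≤ C e^{ct}/N, where ‖μ‖² = ∑_{x∈ℕ} μ(x)² is the ℓ² norm; consequently sup_{ξ∈ℕ^N} |E[m(x, ξ^ξ_t)] − m(·,ξ)T_t(x)| ≤ C e^{ct}/N for every x ∈ ℕ; and (ii) sup_{ξ∈ℕ^N} E[ (m(x, ξ^ξ_t) − m(·,ξ)T_t(x))² ] ≤ C e^{ct}/N for every x ∈ ℕ. -/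

import Mathlib

open MeasureTheory Filter Topology Set

noncomputable section

/-- Jump rates of the continuous-time Galton-Watson process: from `x ≥ 1`,
jump to `x - 1` at rate `x p(0)` and to `y > x` at rate `x p(y - x + 1)`;
the state `0` is absorbing. -/
def gwRate (p : ℕ → ℝ) (x y : ℕ) : ℝ :=
  if 1 ≤ x ∧ y + 1 = x then (x : ℝ) * p 0
  else if 1 ≤ x ∧ x < y then (x : ℝ) * p (y - x + 1)
  else 0

/-- The offspring law: a probability on ℕ with a finite positive exponential
moment and negative (subcritical) drift `-v = ∑_{ℓ ≥ -1} ℓ p(ℓ+1) < 0`. -/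
structure OffspringLaw (p : ℕ → ℝ) (σ v : ℝ) : Prop where
  nonneg : ∀ k, 0 ≤ p k
  total : ∑' k : ℕ, p k = 1
  sigma_pos : 0 < σ
  expMoment : Summable fun k : ℕ => p k * Real.exp (σ * k)
  v_pos : 0 < v
  drift : ∑' k : ℕ, ((k : ℝ) - 1) * p k = -v

/-- Empirical distribution of an `N`-particle configuration. -/
def emp (N : ℕ) (x : ℕ) (ξ : Fin N → ℕ) : ℝ :=
  (N : ℝ)⁻¹ * ∑ i : Fin N, (if ξ i = x then (1 : ℝ) else 0)

/-- Fleming-Viot generator for general driving rates `q`. -/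
def fvGenQ (q : ℕ → ℕ → ℝ) (N : ℕ) (f : (Fin N → ℕ) → ℝ) (ξ : Fin N → ℕ) : ℝ :=
  ∑ i : Fin N, ∑' y : ℕ,
    (if 1 ≤ y then
        q (ξ i) y + q (ξ i) 0 * ((N : ℝ) / ((N : ℝ) - 1)) * emp N y ξ
      else 0) * (f (Function.update ξ i y) - f ξ)

/-- Fleming-Viot generator driven by the Galton-Watson rates. -/
def fvGen (p : ℕ → ℝ) (N : ℕ) : ((Fin N → ℕ) → ℝ) → (Fin N → ℕ) → ℝ :=
  fvGenQ (gwRate p) N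

/-- Bounded real observables. -/
def Bounded {S : Type*} (f : S → ℝ) : Prop := ∃ C, ∀ x, |f x| ≤ C

/-- A Markov transition semigroup on a measurable state space. -/
structure MarkovSemigroup (S : Type*) [MeasurableSpace S] where
  P : ℝ → S → Measure S
  meas : ∀ t, Measurable (P t)
  prob : ∀ t x, IsProbabilityMeasure (P t x)
  init : ∀ x, P 0 x = Measure.dirac x
  semigroup : ∀ s t : ℝ, 0 ≤ s → 0 ≤ t → ∀ x, P (s + t) x = (P s x).bind (P t)

/-- `K` is the transition semigroup of the `N`-particle Fleming-Viot process
driven by the rates `q`: it solves the Kolmogorov equation for the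
Fleming-Viot generator on bounded observables. -/
def IsFVQSemigroup (q : ℕ → ℕ → ℝ) (N : ℕ) (K : MarkovSemigroup (Fin N → ℕ)) : Prop :=
  ∀ f : (Fin N → ℕ) → ℝ, Bounded f → Measurable f → ∀ ξ, ∀ t : ℝ, 0 ≤ t →
    HasDerivWithinAt (fun u => ∫ η, f η ∂ K.P u ξ)
      (∫ η, fvGenQ q N f η ∂ K.P t ξ) (Set.Ici 0) t

/-- `K` is the `N`-particle Fleming-Viot semigroup driven by Galton-Watson. -/
def IsFVSemigroup (p : ℕ → ℝ) (N : ℕ) (K : MarkovSemigroup (Fin N → ℕ)) : Prop :=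
  IsFVQSemigroup (gwRate p) N K

/-- Invariant (stationary) measure of a Markov semigroup. -/
def Invariant {S : Type*} [MeasurableSpace S] (K : MarkovSemigroup S) (μ : Measure S) : Prop :=
  ∀ t : ℝ, 0 ≤ t → μ.bind (K.P t) = μ

/-- Transition probabilities of the Galton-Watson process (absorbed at 0),
characterized by the Kolmogorov backward equations. -/
structure GWTransition (p : ℕ → ℝ) where
  pt : ℝ → ℕ → ℕ → ℝ
  nonneg : ∀ t x y, 0 ≤ pt t x y
  total : ∀ t x, 0 ≤ t → ∑' y : ℕ, pt t x y = 1
  init : ∀ x y, pt 0 x y = if y = x then 1 else 0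
  backward : ∀ x y, ∀ t : ℝ, 0 ≤ t →
    HasDerivWithinAt (fun s => pt s x y)
      (∑' z : ℕ, gwRate p x z * (pt t z y - pt t x y)) (Set.Ici 0) t

/-- The law at time `t` of the process started from `μ`, conditioned on
non-absorption up to time `t`. -/
def condLaw (pt : ℝ → ℕ → ℕ → ℝ) (μ : ℕ → ℝ) (t : ℝ) (y : ℕ) : ℝ :=
  (∑' x : ℕ, μ x * pt t x y) /
    ∑' x : ℕ, ∑' z : ℕ, (if 1 ≤ z then μ x * pt t x z else 0)

def diracOne : ℕ → ℝ := fun x => if x = 1 then 1 else 0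

/-- `ν` is the Yaglom limit (the minimal quasi-stationary distribution). -/
def IsYaglomLimit (pt : ℝ → ℕ → ℕ → ℝ) (ν : ℕ → ℝ) : Prop :=
  ∀ y : ℕ, Tendsto (fun t => condLaw pt diracOne t y) atTop (𝓝 (ν y))

/-- Position of the rightmost particle. -/
def rmax (N : ℕ) (ξ : Fin N → ℕ) : ℕ := Finset.univ.sup ξ

/-- Ratio of the second to the first empirical moment. -/
def psiFun (N : ℕ) (ξ : Fin N → ℕ) : ℝ :=
  (∑ i : Fin N, (ξ i : ℝ) ^ 2) / ∑ i : Fin N, (ξ i : ℝ)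

/-- Configurations of the multitype branching process: `ζ (i, x)` is the
number of type-`i` individuals at site `x`. -/
abbrev BConf (N : ℕ) := Fin N × ℕ → ℕ

/-- Total number of individuals. -/
def bTotal (N : ℕ) (ζ : BConf N) : ENNReal := ∑' w : Fin N × ℕ, (ζ w : ENNReal)

/-- Rightmost occupied site. -/
def bRmax (N : ℕ) (ζ : BConf N) : ℕ := sSup {x : ℕ | ∃ i, ζ (i, x) ≠ 0}

/-- Move one type-`i` individual from `x` to `y`. -/
def bJump (N : ℕ) (ζ : BConf N) (i : Fin N) (x y : ℕ) : BConf N :=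
  fun w => if w = (i, x) then ζ w - 1 else if w = (i, y) then ζ w + 1 else ζ w

/-- Every type-`j` individual gives birth to a type-`i` individual at its own
position. -/
def bBranch (N : ℕ) (ζ : BConf N) (i j : Fin N) : BConf N :=
  fun w => if w.1 = i then ζ w + ζ (j, w.2) else ζ w

/-- Generator of the multitype branching Markov process. -/
def branchGen (q : ℕ → ℕ → ℝ) (qbar : ℝ) (N : ℕ) (f : BConf N → ℝ) (ζ : BConf N) : ℝ :=
  (∑' w : (Fin N × ℕ) × ℕ,
      (ζ w.1 : ℝ) * (if w.2 ≠ 0 ∧ w.2 ≠ w.1.2 then q w.1.2 w.2 else 0) *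
        (f (bJump N ζ w.1.1 w.1.2 w.2) - f ζ))
    + ∑ i : Fin N, ∑ j : Fin N,
        (if j ≠ i then qbar / ((N : ℝ) - 1) * (f (bBranch N ζ i j) - f ζ) else 0)

def IsBranchSemigroup (q : ℕ → ℕ → ℝ) (qbar : ℝ) (N : ℕ)
    (B : MarkovSemigroup (BConf N)) : Prop :=
  ∀ f : BConf N → ℝ, Bounded f → Measurable f → ∀ ζ, ∀ t : ℝ, 0 ≤ t →
    HasDerivWithinAt (fun u => ∫ η, f η ∂ B.P u ζ)
      (∫ η, branchGen q qbar N f η ∂ B.P t ζ) (Set.Ici 0) t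

/-- Generator of the single-particle motion with jumps to `0` suppressed. -/
def tildeGen (q : ℕ → ℕ → ℝ) (f : ℕ → ℝ) (x : ℕ) : ℝ :=
  ∑' y : ℕ, (if y ≠ 0 ∧ y ≠ x then q x y else 0) * (f y - f x)

def IsTildeSemigroup (q : ℕ → ℕ → ℝ) (T : MarkovSemigroup ℕ) : Prop :=
  ∀ f : ℕ → ℝ, Bounded f → ∀ x, ∀ t : ℝ, 0 ≤ t →
    HasDerivWithinAt (fun u => ∫ y, f y ∂ T.P u x)
      (∫ y, tildeGen q f y ∂ T.P t x) (Set.Ici 0) t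

/-- Generator of the Galton-Watson process together with its cumulative birth
counter: from `(z, b)`, jump to `(z + k - 1, b + k)` at rate `z p(k)`. -/
def gwbGen (p : ℕ → ℝ) (f : ℕ × ℕ → ℝ) (w : ℕ × ℕ) : ℝ :=
  ∑' k : ℕ, (w.1 : ℝ) * p k * (f (w.1 + k - 1, w.2 + k) - f w)

def IsGWBSemigroup (p : ℕ → ℝ) (W : MarkovSemigroup (ℕ × ℕ)) : Prop :=
  ∀ f : ℕ × ℕ → ℝ, Bounded f → ∀ w, ∀ t : ℝ, 0 ≤ t →
    HasDerivWithinAt (fun u => ∫ z, f z ∂ W.P u w)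
      (∫ z, gwbGen p f z ∂ W.P t w) (Set.Ici 0) t

/-- `E[exp(σ' H¹)] < ∞`, where `H¹ = 1 + (total number of births)` of the
Galton-Watson process started from one individual; the total number of births
is the increasing limit of the birth counter. -/
def HMomentFinite (W : MarkovSemigroup (ℕ × ℕ)) (σ' : ℝ) : Prop :=
  ∃ M : ℝ, ∀ t : ℝ, 0 ≤ t →
    ∫⁻ w, ENNReal.ofReal (Real.exp (σ' * (1 + (w.2 : ℝ)))) ∂ W.P t (1, 0)
      ≤ ENNReal.ofReal M

/-- The class `F` of test functions: `∑_ℓ e^{-ρℓ} |f(ℓ)| < ∞` for some `ρ < σ'`. -/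
def MemF (σ' : ℝ) (f : ℕ → ℝ) : Prop :=
  ∃ ρ : ℝ, ρ < σ' ∧ Summable fun ℓ : ℕ => Real.exp (-ρ * ℓ) * |f ℓ|

/-- Galton-Watson semigroup `S_t f(x) = E f(Z^x_t)`, read off from the
birth-counting process. -/
def gwS (W : MarkovSemigroup (ℕ × ℕ)) (t : ℝ) (f : ℕ → ℝ) (x : ℕ) : ℝ :=
  ∫ w, f w.1 ∂ W.P t (x, 0)

/-- Galton-Watson generator `Q f(x) = ∑_{ℓ ≥ -1} x p(ℓ+1) (f(x+ℓ) - f(x))`. -/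
def gwQ (p : ℕ → ℝ) (f : ℕ → ℝ) (x : ℕ) : ℝ :=
  ∑' k : ℕ, (x : ℝ) * p k * (f (x + k - 1) - f x)

/-- Reflected Galton-Watson generator
`Q̃ f(x) = ∑_{ℓ ≥ -1} x p(ℓ+1) 1{x+ℓ ≥ 1} (f(x+ℓ) - f(x))`. -/
def gwQRefl (p : ℕ → ℝ) (f : ℕ → ℝ) (x : ℕ) : ℝ :=
  ∑' k : ℕ, (x : ℝ) * p k * (if 1 ≤ x + k - 1 then f (x + k - 1) - f x else 0)

def IsReflSemigroup (p : ℕ → ℝ) (R : MarkovSemigroup ℕ) : Prop :=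
  ∀ f : ℕ → ℝ, Bounded f → ∀ x, ∀ t : ℝ, 0 ≤ t →
    HasDerivWithinAt (fun u => ∫ y, f y ∂ R.P u x)
      (∫ y, gwQRefl p f y ∂ R.P t x) (Set.Ici 0) t

/-- `Γ(ρ) = p(0) + ∑_{ℓ ≥ 1} p(ℓ+1) ℓ² e^{ρℓ}`. -/
def gwGamma (p : ℕ → ℝ) (ρ : ℝ) : ℝ :=
  p 0 + ∑' ℓ : ℕ, p (ℓ + 2) * ((ℓ : ℝ) + 1) ^ 2 * Real.exp (ρ * ((ℓ : ℝ) + 1))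

/-- `β = sup {ρ > 0 : ρ Γ(ρ) ≤ v}`. -/
def gwBeta (p : ℕ → ℝ) (v : ℝ) : ℝ :=
  sSup {ρ : ℝ | 0 < ρ ∧ ρ * gwGamma p ρ ≤ v}

/-- Generating function `G(μ; z) = ∑_x μ(x) z^x`. -/
def genFn (μ : ℕ → ℝ) (z : ℝ) : ℝ := ∑' x : ℕ, μ x * z ^ x

/-- A probability distribution on the positive integers. -/
def IsProbOnPos (μ : ℕ → ℝ) : Prop :=
  (∀ x, 0 ≤ μ x) ∧ μ 0 = 0 ∧ ∑' x : ℕ, μ x = 1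

/-- The class `K(α)`: probabilities on ℕ whose second-to-first moment ratio
is at most `α`. -/
def InK (α : ℝ) (μ : ℕ → ℝ) : Prop :=
  IsProbOnPos μ ∧ (Summable fun x : ℕ => (x : ℝ) ^ 2 * μ x) ∧
    (∑' x : ℕ, (x : ℝ) ^ 2 * μ x) ≤ α * ∑' x : ℕ, (x : ℝ) * μ x

theorem OffspringLaw.summable {p : ℕ → ℝ} {σ v : ℝ} (hp : OffspringLaw p σ v) : Summable p := by
  by_contra h
  have := hp.total
  rw [tsum_eq_zero_of_not_summable h] at this
  exact zero_ne_one this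

theorem OffspringLaw.summable_mul {p : ℕ → ℝ} {σ v : ℝ} (hp : OffspringLaw p σ v) :
    Summable fun k : ℕ => (k : ℝ) * p k := by
  have h : Summable fun k : ℕ => ((k : ℝ) - 1) * p k := by
    by_contra h
    have h1 := hp.drift
    rw [tsum_eq_zero_of_not_summable h] at h1
    linarith [hp.v_pos]
  refine (h.add hp.summable).congr fun k => ?_
  ring

theorem OffspringLaw.zero_le_one {p : ℕ → ℝ} {σ v : ℝ} (hp : OffspringLaw p σ v) : p 0 ≤ 1 := by
  rw [← hp.total]
  exact hp.summable.le_tsum 0 fun k _ => hp.nonneg k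

theorem gwRate_nonneg {p : ℕ → ℝ} (hp : ∀ k, 0 ≤ p k) (x y : ℕ) : 0 ≤ gwRate p x y := by
  unfold gwRate
  split_ifs
  · exact mul_nonneg x.cast_nonneg (hp _)
  · exact mul_nonneg x.cast_nonneg (hp _)
  · exact le_rfl

theorem gwRate_of_zero (p : ℕ → ℝ) (y : ℕ) : gwRate p 0 y = 0 := by
  simp [gwRate]

theorem gwRate_of_lt (p : ℕ → ℝ) {x y : ℕ} (h : y + 1 < x) : gwRate p x y = 0 := by
  unfold gwRate
  rw [if_neg (by omega), if_neg (by omega)]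

theorem gwRate_to_zero (p : ℕ → ℝ) (x : ℕ) : gwRate p x 0 = if x = 1 then p 0 else 0 := by
  unfold gwRate
  by_cases h : x = 1
  · simp [h]
  · rw [if_neg (by omega), if_neg (by omega), if_neg h]

/-- The jump rates have a first absolute moment of at most linear growth. -/
theorem exists_gwRate_moment {p : ℕ → ℝ} {σ v : ℝ} (hp : OffspringLaw p σ v) :
    ∃ M : ℝ, 0 ≤ M ∧ ∀ x : ℕ,
      Summable (fun y : ℕ => gwRate p x y * (|(y : ℝ) - x| + 1)) ∧
        ∑' y : ℕ, gwRate p x y * (|(y : ℝ) - x| + 1) ≤ M * x := by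
  have hs : Summable fun j : ℕ => p (j + 1) * ((j : ℝ) + 1) := by
    have := (summable_nat_add_iff 1).2 hp.summable_mul
    refine this.congr fun j => ?_
    push_cast
    ring
  have hs0 : 0 ≤ ∑' j : ℕ, p (j + 1) * ((j : ℝ) + 1) :=
    tsum_nonneg fun j => mul_nonneg (hp.nonneg _) (by positivity)
  refine ⟨2 * p 0 + ∑' j : ℕ, p (j + 1) * ((j : ℝ) + 1), ?_, fun x => ?_⟩
  · linarith [hp.nonneg 0]
  have hle : ∀ j : ℕ, gwRate p x (j + x) * (|((j + x : ℕ) : ℝ) - x| + 1)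
      ≤ (x : ℝ) * (p (j + 1) * ((j : ℝ) + 1)) := by
    intro j
    have h1 : |((j + x : ℕ) : ℝ) - x| = j := by
      push_cast
      rw [add_sub_cancel_right, abs_of_nonneg j.cast_nonneg]
    have h2 : gwRate p x (j + x) ≤ x * p (j + 1) := by
      unfold gwRate
      rw [if_neg (by omega)]
      split_ifs
      · rw [Nat.add_sub_cancel]
      · exact mul_nonneg x.cast_nonneg (hp.nonneg _)
    rw [h1, ← mul_assoc]
    exact mul_le_mul_of_nonneg_right h2 (by positivity)
  have hnn : ∀ y : ℕ, 0 ≤ gwRate p x y * (|(y : ℝ) - x| + 1) := fun y =>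
    mul_nonneg (gwRate_nonneg hp.nonneg _ _) (by positivity)
  have hshift : Summable fun j : ℕ =>
      gwRate p x (j + x) * (|((j + x : ℕ) : ℝ) - x| + 1) :=
    Summable.of_nonneg_of_le (fun j => hnn _) hle (hs.mul_left _)
  have hsum : Summable (fun y : ℕ => gwRate p x y * (|(y : ℝ) - x| + 1)) :=
    (summable_nat_add_iff x).1 hshift
  refine ⟨hsum, ?_⟩
  rw [← hsum.sum_add_tsum_nat_add x]
  have h3 : ∑ y ∈ Finset.range x, gwRate p x y * (|(y : ℝ) - x| + 1) ≤ 2 * p 0 * x := by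
    rcases x with _ | z
    · simp
    rw [Finset.sum_eq_single z]
    · have : gwRate p (z + 1) z = ((z + 1 : ℕ) : ℝ) * p 0 := by simp [gwRate]
      rw [this]
      have h4 : |(z : ℝ) - ((z + 1 : ℕ) : ℝ)| = 1 := by
        push_cast
        rw [sub_add_cancel_left, abs_neg, abs_one]
      rw [h4]
      exact le_of_eq (by ring)
    · intro y hy hyz
      rw [gwRate_of_lt p (by have := Finset.mem_range.1 hy; omega), zero_mul]
    · intro h
      exact absurd (Finset.mem_range.2 (Nat.lt_succ_self z)) h
  have h5 := hshift.tsum_le_tsum hle (hs.mul_left (x : ℝ))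
  rw [tsum_mul_left] at h5
  linarith

theorem summable_gwRate {p : ℕ → ℝ} {σ v : ℝ} (hp : OffspringLaw p σ v) (x : ℕ) :
    Summable fun y => gwRate p x y := by
  obtain ⟨M, -, hM⟩ := exists_gwRate_moment hp
  refine Summable.of_nonneg_of_le (fun y => gwRate_nonneg hp.nonneg x y) (fun y => ?_) (hM x).1
  exact le_mul_of_one_le_right (gwRate_nonneg hp.nonneg x y)
    (by linarith [abs_nonneg ((y : ℝ) - x)])

/-- Average of `φ` over the particles of a configuration. -/
def empMean (N : ℕ) (φ : ℕ → ℝ) (η : Fin N → ℕ) : ℝ := (N : ℝ)⁻¹ * ∑ i : Fin N, φ (η i)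

theorem hasSum_emp_mul (N : ℕ) (φ : ℕ → ℝ) (η : Fin N → ℕ) :
    HasSum (fun y => emp N y η * φ y) (empMean N φ η) := by
  have h : HasSum (fun y => (N : ℝ)⁻¹ * ∑ i : Fin N, (if η i = y then φ y else 0))
      (empMean N φ η) := by
    refine HasSum.mul_left _ (hasSum_sum fun i _ => ?_)
    have := hasSum_single (f := fun y => if η i = y then φ y else 0) (η i)
      (fun y hy => if_neg (Ne.symm hy))
    simpa using this
  refine h.congr_fun fun y => ?_
  rw [emp, mul_assoc, Finset.sum_mul]
  simp only [ite_mul, one_mul, zero_mul]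

theorem emp_nonneg (N y : ℕ) (η : Fin N → ℕ) : 0 ≤ emp N y η := by
  unfold emp
  refine mul_nonneg (by positivity) (Finset.sum_nonneg fun i _ => ?_)
  split_ifs <;> norm_num

theorem emp_zero {N : ℕ} {η : Fin N → ℕ} (hη : ∀ i, 1 ≤ η i) : emp N 0 η = 0 := by
  unfold emp
  rw [Finset.sum_eq_zero, mul_zero]
  intro i _
  rw [if_neg (by have := hη i; omega)]

theorem empMean_update (N : ℕ) (φ : ℕ → ℝ) (η : Fin N → ℕ) (i : Fin N) (y : ℕ) :
    empMean N φ (Function.update η i y) = empMean N φ η + (N : ℝ)⁻¹ * (φ y - φ (η i)) := by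
  unfold empMean
  rw [← mul_add, ← Finset.add_sum_erase _ _ (Finset.mem_univ i),
    ← Finset.add_sum_erase _ (fun j => φ (η j)) (Finset.mem_univ i), Function.update_self]
  rw [Finset.sum_congr rfl (g := fun j => φ (η j))]
  · ring
  · intro j hj
    rw [Function.update_of_ne (Finset.ne_of_mem_erase hj)]

theorem div_sub_one_mem {N : ℕ} (hN : 1 ≤ N) :
    0 ≤ (N : ℝ) / ((N : ℝ) - 1) ∧ (N : ℝ) / ((N : ℝ) - 1) ≤ 2 := by
  rcases hN.eq_or_lt with rfl | h
  · norm_num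
  have h2 : (2 : ℝ) ≤ N := by exact_mod_cast h
  exact ⟨div_nonneg (by linarith) (by linarith), by rw [div_le_iff₀ (by linarith)]; linarith⟩

/-- Rate at which particle `i` of the Fleming-Viot system jumps to `y`. -/
def fvRate (p : ℕ → ℝ) (N : ℕ) (η : Fin N → ℕ) (i : Fin N) (y : ℕ) : ℝ :=
  if 1 ≤ y then
    gwRate p (η i) y + gwRate p (η i) 0 * ((N : ℝ) / ((N : ℝ) - 1)) * emp N y η
  else 0

theorem fvGen_eq (p : ℕ → ℝ) (N : ℕ) (f : (Fin N → ℕ) → ℝ) (η : Fin N → ℕ) :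
    fvGen p N f η
      = ∑ i : Fin N, ∑' y : ℕ, fvRate p N η i y * (f (Function.update η i y) - f η) := rfl

theorem fvRate_nonneg {p : ℕ → ℝ} (hp : ∀ k, 0 ≤ p k) {N : ℕ} (hN : 1 ≤ N)
    (η : Fin N → ℕ) (i : Fin N) (y : ℕ) : 0 ≤ fvRate p N η i y := by
  unfold fvRate
  split_ifs
  · exact add_nonneg (gwRate_nonneg hp _ _) (mul_nonneg (mul_nonneg (gwRate_nonneg hp _ _)
      (div_sub_one_mem hN).1) (emp_nonneg _ _ _))
  · exact le_rfl

theorem fvRate_of_zero (p : ℕ → ℝ) {N : ℕ} {η : Fin N → ℕ} {i : Fin N} (h : η i = 0) (y : ℕ) :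
    fvRate p N η i y = 0 := by
  simp [fvRate, h, gwRate_of_zero]

theorem fvRate_of_lt (p : ℕ → ℝ) {N : ℕ} {η : Fin N → ℕ} {i : Fin N} {y : ℕ}
    (h : y + 1 < η i) : fvRate p N η i y = 0 := by
  unfold fvRate
  split_ifs with hy
  · rw [gwRate_of_lt p h, gwRate_of_lt p (by omega)]
    ring
  · rfl

/-- The total jump rate, weighted by displacement, grows at most linearly. -/
theorem exists_fvRate_moment {p : ℕ → ℝ} {σ v : ℝ} (hp : OffspringLaw p σ v) {N : ℕ}
    (hN : 1 ≤ N) :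
    ∃ M : ℝ, 0 ≤ M ∧ ∀ η : Fin N → ℕ,
      (∀ i, Summable fun y : ℕ => fvRate p N η i y * (|(y : ℝ) - η i| + 1)) ∧
        ∑ i, ∑' y : ℕ, fvRate p N η i y * (|(y : ℝ) - η i| + 1) ≤ M * ((∑ i, η i : ℕ) : ℝ) := by
  obtain ⟨M, hM0, hM⟩ := exists_gwRate_moment hp
  have hNpos : (0 : ℝ) < N := by exact_mod_cast hN
  refine ⟨M + 6 * p 0, by linarith [hp.nonneg 0], fun η => ?_⟩
  have hS := fun i => hasSum_emp_mul N (fun y => |(y : ℝ) - η i| + 1) η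
  set r : Fin N → ℝ := fun i => gwRate p (η i) 0 * ((N : ℝ) / ((N : ℝ) - 1)) with hr
  have hr0 : ∀ i, 0 ≤ r i := fun i =>
    mul_nonneg (gwRate_nonneg hp.nonneg _ _) (div_sub_one_mem hN).1
  have hle : ∀ i (y : ℕ), fvRate p N η i y * (|(y : ℝ) - η i| + 1)
      ≤ gwRate p (η i) y * (|(y : ℝ) - η i| + 1)
        + r i * (emp N y η * (|(y : ℝ) - η i| + 1)) := by
    intro i y
    rw [← mul_assoc, ← add_mul]
    refine mul_le_mul_of_nonneg_right ?_ (by positivity)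
    unfold fvRate
    split_ifs
    · exact le_rfl
    · exact add_nonneg (gwRate_nonneg hp.nonneg _ _) (mul_nonneg (hr0 i) (emp_nonneg _ _ _))
  have hsum2 : ∀ i, HasSum (fun y : ℕ => gwRate p (η i) y * (|(y : ℝ) - η i| + 1)
        + r i * (emp N y η * (|(y : ℝ) - η i| + 1))) _ := fun i =>
    (hM (η i)).1.hasSum.add ((hS i).mul_left (r i))
  have hsum : ∀ i, Summable fun y : ℕ => fvRate p N η i y * (|(y : ℝ) - η i| + 1) := fun i =>
    Summable.of_nonneg_of_le
      (fun y => mul_nonneg (fvRate_nonneg hp.nonneg hN _ _ _) (by positivity)) (hle i)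
      (hsum2 i).summable
  refine ⟨hsum, ?_⟩
  have hV : ∀ i, r i * empMean N (fun y => |(y : ℝ) - η i| + 1) η
      ≤ 2 * p 0 * ((N : ℝ)⁻¹ * ∑ j, (η j : ℝ)) + 4 * p 0 * η i := by
    intro i
    by_cases h1 : η i = 1
    · have e1 : empMean N (fun y => |(y : ℝ) - η i| + 1) η ≤ (N : ℝ)⁻¹ * ∑ j, (η j : ℝ) + 2 := by
        unfold empMean
        have : ∑ j, (|(η j : ℝ) - η i| + 1) ≤ ∑ j, ((η j : ℝ) + 2) := by
          refine Finset.sum_le_sum fun j _ => ?_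
          rw [h1]
          have : |(η j : ℝ) - (1 : ℕ)| ≤ η j + 1 := by
            rw [abs_le]
            have : (0 : ℝ) ≤ η j := (η j).cast_nonneg
            constructor <;> push_cast <;> linarith
          linarith
        calc _ ≤ (N : ℝ)⁻¹ * ∑ j, ((η j : ℝ) + 2) :=
              mul_le_mul_of_nonneg_left this (by positivity)
          _ = _ := by
            rw [Finset.sum_add_distrib]
            simp only [Finset.sum_const, Finset.card_univ, Fintype.card_fin, nsmul_eq_mul]
            field_simp
      have e2 : r i ≤ p 0 * 2 := by
        simp only [hr, gwRate_to_zero, h1, if_true]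
        exact mul_le_mul_of_nonneg_left (div_sub_one_mem hN).2 (hp.nonneg 0)
      have e3 : (0 : ℝ) ≤ (N : ℝ)⁻¹ * ∑ j, (η j : ℝ) + 2 := by positivity
      calc _ ≤ r i * ((N : ℝ)⁻¹ * ∑ j, (η j : ℝ) + 2) := mul_le_mul_of_nonneg_left e1 (hr0 i)
        _ ≤ p 0 * 2 * ((N : ℝ)⁻¹ * ∑ j, (η j : ℝ) + 2) := mul_le_mul_of_nonneg_right e2 e3
        _ = _ := by rw [h1]; push_cast; ring
    · have : r i = 0 := by simp [hr, gwRate_to_zero, h1]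
      rw [this, zero_mul]
      have := hp.nonneg 0
      positivity
  calc ∑ i, ∑' y : ℕ, fvRate p N η i y * (|(y : ℝ) - η i| + 1)
      ≤ ∑ i, (M * η i + (2 * p 0 * ((N : ℝ)⁻¹ * ∑ j, (η j : ℝ)) + 4 * p 0 * η i)) := by
        refine Finset.sum_le_sum fun i _ => ?_
        have := (hsum i).tsum_le_tsum (hle i) (hsum2 i).summable
        rw [(hsum2 i).tsum_eq] at this
        linarith [(hM (η i)).2, hV i]
    _ = (M + 6 * p 0) * ((∑ i, η i : ℕ) : ℝ) := by
        simp only [Finset.sum_add_distrib, ← Finset.mul_sum, Finset.sum_const, Finset.card_univ,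
          Fintype.card_fin, nsmul_eq_mul]
        push_cast
        field_simp
        ring

theorem summable_fvRate {p : ℕ → ℝ} {σ v : ℝ} (hp : OffspringLaw p σ v) {N : ℕ}
    (hN : 1 ≤ N) (η : Fin N → ℕ) (i : Fin N) : Summable fun y => fvRate p N η i y := by
  obtain ⟨M, -, hM⟩ := exists_fvRate_moment hp hN
  refine Summable.of_nonneg_of_le (fun y => fvRate_nonneg hp.nonneg hN η i y) (fun y => ?_)
    ((hM η).1 i)
  exact le_mul_of_one_le_right (fvRate_nonneg hp.nonneg hN η i y)
    (by linarith [abs_nonneg ((y : ℝ) - η i)])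

theorem summable_fvRate_mul {p : ℕ → ℝ} {σ v : ℝ} (hp : OffspringLaw p σ v) {N : ℕ}
    (hN : 1 ≤ N) (η : Fin N → ℕ) (i : Fin N) {φ : ℕ → ℝ} {A : ℝ}
    (hφ : ∀ y, fvRate p N η i y ≠ 0 → |φ y| ≤ A) :
    Summable fun y => fvRate p N η i y * φ y := by
  refine Summable.of_norm_bounded ((summable_fvRate hp hN η i).mul_left A) fun y => ?_
  have h0 := fvRate_nonneg hp.nonneg hN η i y
  rw [Real.norm_eq_abs, abs_mul, abs_of_nonneg h0, mul_comm]
  by_cases h : fvRate p N η i y = 0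
  · simp [h]
  · exact mul_le_mul_of_nonneg_right (hφ y h) h0

theorem cast_sum_update {N : ℕ} (η : Fin N → ℕ) (i : Fin N) (y : ℕ) :
    ((∑ j, Function.update η i y j : ℕ) : ℝ) = ((∑ j, η j : ℕ) : ℝ) + ((y : ℝ) - η i) := by
  rw [← Finset.add_sum_erase _ _ (Finset.mem_univ i),
    ← Finset.add_sum_erase _ η (Finset.mem_univ i), Function.update_self,
    Finset.sum_congr rfl (g := η)]
  · push_cast
    ring
  · intro j hj
    rw [Function.update_of_ne (Finset.ne_of_mem_erase hj)]

/-- A jump never decreases the total position by more than one. -/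
theorem sum_le_sum_update_add_one {p : ℕ → ℝ} {N : ℕ} {η : Fin N → ℕ} {i : Fin N} {y : ℕ}
    (h : fvRate p N η i y ≠ 0) : ∑ j, η j ≤ (∑ j, Function.update η i y j) + 1 := by
  have h1 : η i ≤ y + 1 := by
    by_contra h2
    exact h (fvRate_of_lt p (by omega))
  have h2 := cast_sum_update η i y
  have h3 : (η i : ℝ) ≤ y + 1 := by exact_mod_cast h1
  have h4 : ((∑ j, η j : ℕ) : ℝ) ≤ ((∑ j, Function.update η i y j : ℕ) : ℝ) + 1 := by linarith
  exact_mod_cast h4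

theorem one_le_update_of_fvRate_ne_zero {p : ℕ → ℝ} {N : ℕ} {η : Fin N → ℕ} {i : Fin N} {y : ℕ}
    (h : fvRate p N η i y ≠ 0) (hη : ∀ j, 1 ≤ η j) (j : Fin N) :
    1 ≤ Function.update η i y j := by
  have hy : 1 ≤ y := by
    by_contra h2
    exact h (by simp [fvRate, h2])
  by_cases hj : j = i
  · subst hj
    rwa [Function.update_self]
  · rw [Function.update_of_ne hj]
    exact hη j

theorem fvGen_eq_zero {p : ℕ → ℝ} {N : ℕ} {f : (Fin N → ℕ) → ℝ} {η : Fin N → ℕ}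
    (h : ∀ i y, fvRate p N η i y ≠ 0 → f (Function.update η i y) = f η) : fvGen p N f η = 0 := by
  rw [fvGen_eq]
  refine Finset.sum_eq_zero fun i _ => ?_
  rw [← tsum_zero (α := ℝ) (β := ℕ)]
  congr 1
  funext y
  by_cases h0 : fvRate p N η i y = 0
  · rw [h0, zero_mul]
  · rw [h i y h0, sub_self, mul_zero]

theorem fvGen_eq_zero_of_lt_sum {p : ℕ → ℝ} {N n : ℕ} {f : (Fin N → ℕ) → ℝ} {c : ℝ}
    (hf : ∀ ζ : Fin N → ℕ, n ≤ ∑ j, ζ j → f ζ = c) {η : Fin N → ℕ} (hη : n < ∑ j, η j) :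
    fvGen p N f η = 0 := by
  refine fvGen_eq_zero fun i y h => ?_
  rw [hf η hη.le, hf _ (by have := sum_le_sum_update_add_one h; omega)]

theorem integrable_of_abs_le {S : Type*} [MeasurableSpace S] [DiscreteMeasurableSpace S]
    [Countable S] {μ : Measure S} [IsProbabilityMeasure μ] {f : S → ℝ} {A : ℝ}
    (hf : ∀ x, |f x| ≤ A) : Integrable f μ :=
  Integrable.of_bound (Measurable.of_discrete.aestronglyMeasurable) A
    (Eventually.of_forall hf)

/-- The finite box containing all configurations of total position at most `n`. -/
def confBox (N n : ℕ) : Finset (Fin N → ℕ) := Fintype.piFinset fun _ => Finset.range (n + 1)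

theorem lt_sum_of_notMem_confBox {N n : ℕ} {η : Fin N → ℕ} (h : η ∉ confBox N n) :
    n < ∑ j, η j := by
  by_contra h2
  refine h (Fintype.mem_piFinset.2 fun i => Finset.mem_range.2 ?_)
  have := Finset.single_le_sum (f := η) (fun j _ => Nat.zero_le _) (Finset.mem_univ i)
  omega

theorem abs_le_sum_of_support {S : Type*} {T : Finset S} {f : S → ℝ} (hf : ∀ x ∉ T, f x = 0)
    (x : S) : |f x| ≤ ∑ y ∈ T, |f y| := by
  by_cases hx : x ∈ T
  · exact Finset.single_le_sum (f := fun y => |f y|) (fun y _ => abs_nonneg _) hx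
  · rw [hf x hx, abs_zero]
    exact Finset.sum_nonneg fun y _ => abs_nonneg _

theorem integral_eq_sum_of_support {S : Type*} [MeasurableSpace S] [DiscreteMeasurableSpace S]
    [Countable S] [DecidableEq S] {μ : Measure S} [IsProbabilityMeasure μ] {T : Finset S}
    {f : S → ℝ} (hf : ∀ x ∉ T, f x = 0) :
    ∫ x, f x ∂μ = ∑ z ∈ T, (∫ x, (if x = z then (1 : ℝ) else 0) ∂μ) * f z := by
  have h : f = fun x => ∑ z ∈ T, (if x = z then (1 : ℝ) else 0) * f z := by
    funext x
    simp only [ite_mul, one_mul, zero_mul, Finset.sum_ite_eq]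
    split_ifs with hx
    · rfl
    · exact hf x hx
  conv_lhs => rw [h]
  rw [integral_finsetSum]
  · exact Finset.sum_congr rfl fun z _ => integral_mul_const _ _
  · intro z _
    refine Integrable.mul_const (integrable_of_abs_le (A := 1) fun x => ?_) _
    split_ifs <;> norm_num

/-- Time derivative of the expectation of a finitely supported time-dependent observable. -/
theorem hasDerivWithinAt_integral_of_support {p : ℕ → ℝ} {N : ℕ} {K : MarkovSemigroup (Fin N → ℕ)}
    (hK : IsFVSemigroup p N K) (ξ : Fin N → ℕ) {T : Finset (Fin N → ℕ)}
    {G : ℝ → (Fin N → ℕ) → ℝ} {G' : (Fin N → ℕ) → ℝ} {s : ℝ} (hs : 0 ≤ s)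
    (hG : ∀ u, ∀ η ∉ T, G u η = 0) (hG' : ∀ η ∉ T, G' η = 0)
    (hd : ∀ η ∈ T, HasDerivWithinAt (fun u => G u η) (G' η) (Ici s) s) :
    HasDerivWithinAt (fun u => ∫ η, G u η ∂K.P u ξ)
      ((∫ η, G' η ∂K.P s ξ) + ∫ η, fvGen p N (G s) η ∂K.P s ξ) (Ici s) s := by
  classical
  have := K.prob
  set π : ℝ → (Fin N → ℕ) → ℝ := fun u z => ∫ η, (if η = z then (1 : ℝ) else 0) ∂K.P u ξ with hπ
  have hsub : Ici s ⊆ Ici (0 : ℝ) := Ici_subset_Ici.2 hs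
  have hdπ : ∀ z, ∃ d, HasDerivWithinAt (fun u => π u z) d (Ici s) s := fun z =>
    ⟨_, (hK (fun η => if η = z then (1 : ℝ) else 0)
      ⟨1, fun x => by dsimp only; split_ifs <;> norm_num⟩ Measurable.of_discrete ξ s hs).mono hsub⟩
  choose d hd' using hdπ
  have h1 : HasDerivWithinAt (fun u => ∫ η, G s η ∂K.P u ξ)
      (∑ z ∈ T, d z * G s z) (Ici s) s := by
    simp_rw [fun u => integral_eq_sum_of_support (μ := K.P u ξ) (hG s)]
    exact HasDerivWithinAt.fun_sum fun z _ => (hd' z).mul_const _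
  have h2 := (hK (G s) ⟨_, abs_le_sum_of_support (hG s)⟩ Measurable.of_discrete ξ s hs).mono hsub
  have h3 : ∑ z ∈ T, d z * G s z = ∫ η, fvGen p N (G s) η ∂K.P s ξ :=
    (uniqueDiffOn_Ici s s self_mem_Ici).eq_deriv _ h1 h2
  simp_rw [fun u => integral_eq_sum_of_support (μ := K.P u ξ) (hG u)]
  rw [integral_eq_sum_of_support (μ := K.P s ξ) hG', ← h3, add_comm, ← Finset.sum_add_distrib]
  exact HasDerivWithinAt.fun_sum fun z hz => (hd' z).mul (hd z hz)

theorem integral_initial {S : Type*} [MeasurableSpace S] [DiscreteMeasurableSpace S]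
    (K : MarkovSemigroup S) (f : S → ℝ) (x : S) : ∫ y, f y ∂K.P 0 x = f x := by
  rw [K.init, integral_dirac]

/-- Expected truncated total position grows at most exponentially. -/
theorem exists_integral_min_total_le {p : ℕ → ℝ} {σ v : ℝ} (hp : OffspringLaw p σ v) {N : ℕ}
    (hN : 1 ≤ N) {K : MarkovSemigroup (Fin N → ℕ)} (hK : IsFVSemigroup p N K) :
    ∃ M : ℝ, 0 ≤ M ∧ ∀ (n : ℕ) (ξ : Fin N → ℕ) (t : ℝ), 0 ≤ t →
      ∫ η, min ((∑ i, η i : ℕ) : ℝ) n ∂K.P t ξ ≤ Real.exp (M * t) * ((∑ i, ξ i : ℕ) : ℝ) := by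
  obtain ⟨M, hM0, hM⟩ := exists_fvRate_moment hp hN
  have := K.prob
  refine ⟨M, hM0, fun n ξ t ht => ?_⟩
  set f : (Fin N → ℕ) → ℝ := fun η => min ((∑ i, η i : ℕ) : ℝ) n with hf
  have hf0 : ∀ η, 0 ≤ f η := fun η => le_min (Nat.cast_nonneg _) n.cast_nonneg
  have hfb : ∀ η, |f η| ≤ n := fun η => by
    rw [abs_of_nonneg (hf0 η)]
    exact min_le_right _ _
  have hconst : ∀ ζ : Fin N → ℕ, n ≤ ∑ j, ζ j → f ζ = n := fun ζ hζ =>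
    min_eq_right (by exact_mod_cast hζ)
  have hL0 : ∀ η ∉ confBox N n, fvGen p N f η = 0 := fun η hη =>
    fvGen_eq_zero_of_lt_sum hconst (lt_sum_of_notMem_confBox hη)
  have hL : ∀ η, fvGen p N f η ≤ M * f η := by
    intro η
    rcases lt_or_ge n (∑ j, η j) with h | h
    · rw [fvGen_eq_zero_of_lt_sum hconst h]
      exact mul_nonneg hM0 (hf0 η)
    have hfη : f η = ((∑ i, η i : ℕ) : ℝ) := min_eq_left (by exact_mod_cast h)
    rw [hfη, fvGen_eq]
    refine le_trans (Finset.sum_le_sum fun i _ => ?_) (hM η).2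
    refine Summable.tsum_le_tsum (fun y => ?_)
      (summable_fvRate_mul hp hN η i (A := n + n) fun y _ => ?_) ((hM η).1 i)
    · refine mul_le_mul_of_nonneg_left ?_ (fvRate_nonneg hp.nonneg hN _ _ _)
      have h1 : f (Function.update η i y) ≤ ((∑ i, η i : ℕ) : ℝ) + ((y : ℝ) - η i) := by
        rw [← cast_sum_update]
        exact min_le_left _ _
      linarith [le_abs_self ((y : ℝ) - η i)]
    · exact (abs_sub _ _).trans (add_le_add (hfb _) (hfb _))
  have hd := fun u (hu : 0 ≤ u) => hK f ⟨_, hfb⟩ Measurable.of_discrete ξ u hu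
  have hle : ∀ u, ∫ η, fvGen p N f η ∂K.P u ξ ≤ M * ∫ η, f η ∂K.P u ξ := by
    intro u
    rw [← integral_const_mul]
    exact integral_mono (integrable_of_abs_le (abs_le_sum_of_support hL0))
      ((integrable_of_abs_le hfb).const_mul M) hL
  have hexp : ∀ u : ℝ, HasDerivAt (fun u => Real.exp (-M * u)) (-M * Real.exp (-M * u)) u := by
    intro u
    have h := ((hasDerivAt_id' u).const_mul (-M)).exp
    rwa [mul_one, mul_comm] at h
  have key := image_le_of_deriv_right_le_deriv_boundary
    (f := fun u => Real.exp (-M * u) * ∫ η, f η ∂K.P u ξ) (a := 0) (b := t)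
    (f' := fun u => -M * Real.exp (-M * u) * (∫ η, f η ∂K.P u ξ)
      + Real.exp (-M * u) * ∫ η, fvGen p N f η ∂K.P u ξ)
    (B := fun _ => f ξ) (B' := fun _ => 0)
    (fun u hu => ((hexp u).hasDerivWithinAt.mul
      ((hd u hu.1).mono Icc_subset_Ici_self)).continuousWithinAt)
    (fun u hu => (hexp u).hasDerivWithinAt.mul ((hd u hu.1).mono (Ici_subset_Ici.2 hu.1)))
    (by simp [integral_initial])
    continuousOn_const (fun u _ => hasDerivWithinAt_const _ _ _)
    (fun u hu => by
      have := mul_le_mul_of_nonneg_left (hle u) (Real.exp_pos (-M * u)).le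
      linarith)
    (right_mem_Icc.2 ht)
  have h1 : f ξ ≤ ((∑ i, ξ i : ℕ) : ℝ) := min_le_left _ _
  calc ∫ η, f η ∂K.P t ξ
      = Real.exp (M * t) * (Real.exp (-M * t) * ∫ η, f η ∂K.P t ξ) := by
        rw [← mul_assoc, ← Real.exp_add, ← add_mul, add_neg_cancel, zero_mul, Real.exp_zero,
          one_mul]
    _ ≤ _ := mul_le_mul_of_nonneg_left (key.trans h1) (Real.exp_pos _).le

/-- Spatial cutoff, equal to one near the origin and vanishing at total position `n + 1`. -/
def cutoff (N n : ℕ) (η : Fin N → ℕ) : ℝ := max 0 (1 - ((∑ i, η i : ℕ) : ℝ) / (n + 1))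

theorem cutoff_nonneg (N n : ℕ) (η : Fin N → ℕ) : 0 ≤ cutoff N n η := le_max_left _ _

theorem cutoff_le_one (N n : ℕ) (η : Fin N → ℕ) : cutoff N n η ≤ 1 :=
  max_le zero_le_one (by
    have : 0 ≤ ((∑ i, η i : ℕ) : ℝ) / (n + 1) := by positivity
    linarith)

theorem cutoff_eq_zero {N n : ℕ} {η : Fin N → ℕ} (h : n + 1 ≤ ∑ i, η i) : cutoff N n η = 0 := by
  refine max_eq_left (sub_nonpos.2 ?_)
  rw [le_div_iff₀ (by positivity), one_mul]
  exact_mod_cast h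

theorem tendsto_cutoff (N : ℕ) (η : Fin N → ℕ) :
    Tendsto (fun n => cutoff N n η) atTop (𝓝 1) := by
  have h : Tendsto (fun n : ℕ => ((∑ i, η i : ℕ) : ℝ) / ((n : ℝ) + 1)) atTop (𝓝 0) := by
    simpa [div_eq_mul_inv] using
      tendsto_one_div_add_atTop_nhds_zero_nat.const_mul ((∑ i, η i : ℕ) : ℝ)
  have := (tendsto_const_nhds (x := (0 : ℝ))).max (h.const_sub 1)
  simpa [cutoff] using this

theorem abs_cutoff_update_sub_le (N n : ℕ) (η : Fin N → ℕ) (i : Fin N) (y : ℕ) :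
    |cutoff N n (Function.update η i y) - cutoff N n η| ≤ (|(y : ℝ) - η i| + 1) / (n + 1) := by
  unfold cutoff
  rw [cast_sum_update]
  refine (abs_max_sub_max_le_max _ _ _ _).trans ?_
  rw [sub_self, abs_zero, max_eq_right (abs_nonneg _)]
  have h : (1 - (((∑ i, η i : ℕ) : ℝ) + ((y : ℝ) - η i)) / ((n : ℝ) + 1))
      - (1 - ((∑ i, η i : ℕ) : ℝ) / (n + 1)) = -(((y : ℝ) - η i) / (n + 1)) := by ring
  rw [h, abs_neg, abs_div, abs_of_pos (by positivity : (0 : ℝ) < n + 1)]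
  gcongr
  linarith

/-- **Comparison principle.** A bounded time-dependent observable whose space-time generator is at
most `B` on configurations of positive particles has expectation growing at rate at most `B`. -/
theorem fv_comparison {p : ℕ → ℝ} {σ v : ℝ} (hp : OffspringLaw p σ v) {N : ℕ} (hN : 1 ≤ N)
    {K : MarkovSemigroup (Fin N → ℕ)} (hK : IsFVSemigroup p N K) {t : ℝ} (ht : 0 ≤ t)
    {Ψ Ψ' : ℝ → (Fin N → ℕ) → ℝ} {A B : ℝ} (hB : 0 ≤ B)
    (hbd : ∀ s ∈ Icc 0 t, ∀ η, (∀ i, 1 ≤ η i) → |Ψ s η| ≤ A)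
    (hcont : ∀ η, (∀ i, 1 ≤ η i) → ContinuousOn (fun s => Ψ s η) (Icc 0 t))
    (hderiv : ∀ s ∈ Ico 0 t, ∀ η, (∀ i, 1 ≤ η i) →
      HasDerivWithinAt (fun s => Ψ s η) (Ψ' s η) (Ici s) s)
    (hgen : ∀ s ∈ Ico 0 t, ∀ η, (∀ i, 1 ≤ η i) → Ψ' s η + fvGen p N (Ψ s) η ≤ B)
    {ξ : Fin N → ℕ} (hξ : ∀ i, 1 ≤ ξ i) :
    ∫ η, (if ∀ i, 1 ≤ η i then Ψ t η else 0) ∂K.P t ξ ≤ Ψ 0 ξ + B * t := by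
  classical
  have := K.prob
  obtain ⟨M, hM0, hM⟩ := exists_fvRate_moment hp hN
  obtain ⟨M₁, hM₁0, hM₁⟩ := exists_integral_min_total_le hp hN hK
  have hA : 0 ≤ A := (abs_nonneg _).trans (hbd 0 (left_mem_Icc.2 ht) ξ hξ)
  have hgenG : ∀ n : ℕ, ∀ s ∈ Ico 0 t, ∀ η : Fin N → ℕ,
      (if ∀ i, 1 ≤ η i then cutoff N n η * Ψ' s η else 0)
        + fvGen p N (fun ζ => if ∀ i, 1 ≤ ζ i then cutoff N n ζ * Ψ s ζ else 0) η
      ≤ B + A * M / (n + 1) * min ((∑ i, η i : ℕ) : ℝ) ((n + 1 : ℕ) : ℝ) := by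
    intro n s hs η
    have hpos : 0 ≤ A * M / (n + 1) * min ((∑ i, η i : ℕ) : ℝ) ((n + 1 : ℕ) : ℝ) := by positivity
    by_cases hη : ∀ i, 1 ≤ η i
    swap
    · rw [if_neg hη, fvGen_eq_zero]
      · linarith
      intro i y h
      obtain ⟨j, hj⟩ := not_forall.1 hη
      rw [if_neg hη, if_neg]
      intro hall
      refine hj ?_
      have hji : j ≠ i := by
        rintro rfl
        exact h (fvRate_of_zero p (by omega) y)
      have := hall j
      rwa [Function.update_of_ne hji] at this
    rcases lt_or_ge (n + 1) (∑ j, η j) with h | h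
    · rw [if_pos hη, cutoff_eq_zero h.le, fvGen_eq_zero_of_lt_sum (n := n + 1) (c := 0) ?_ h]
      · linarith
      · intro ζ hζ
        simp [cutoff_eq_zero hζ]
    rw [if_pos hη, min_eq_left (by exact_mod_cast h)]
    have hsI : s ∈ Icc 0 t := ⟨hs.1, hs.2.le⟩
    have hg := hgen s hs η hη
    rw [fvGen_eq] at hg ⊢
    have hterm : ∀ i (y : ℕ), fvRate p N η i y *
        ((if ∀ j, 1 ≤ Function.update η i y j then
            cutoff N n (Function.update η i y) * Ψ s (Function.update η i y) else 0)
          - (if ∀ j, 1 ≤ η j then cutoff N n η * Ψ s η else 0))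
        ≤ cutoff N n η * (fvRate p N η i y * (Ψ s (Function.update η i y) - Ψ s η))
          + A / (n + 1) * (fvRate p N η i y * (|(y : ℝ) - η i| + 1)) := by
      intro i y
      by_cases h0 : fvRate p N η i y = 0
      · simp [h0]
      have hup := one_le_update_of_fvRate_ne_zero h0 hη
      rw [if_pos hη, if_pos hup]
      have h1 : Ψ s (Function.update η i y)
          * (cutoff N n (Function.update η i y) - cutoff N n η)
          ≤ A * ((|(y : ℝ) - η i| + 1) / (n + 1)) := by
        refine (le_abs_self _).trans ?_
        rw [abs_mul]
        exact mul_le_mul (hbd s hsI _ hup) (abs_cutoff_update_sub_le N n η i y) (abs_nonneg _) hA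
      have h2 := mul_le_mul_of_nonneg_left h1 (fvRate_nonneg hp.nonneg hN η i y)
      calc _ = cutoff N n η * (fvRate p N η i y * (Ψ s (Function.update η i y) - Ψ s η))
            + fvRate p N η i y * (Ψ s (Function.update η i y)
              * (cutoff N n (Function.update η i y) - cutoff N n η)) := by ring
        _ ≤ _ := by
          refine (add_le_add_right h2 _).trans (le_of_eq ?_)
          ring
    have hsum1 : ∀ i, Summable fun y =>
        fvRate p N η i y * (Ψ s (Function.update η i y) - Ψ s η) := fun i =>
      summable_fvRate_mul hp hN η i (A := A + A) fun y h0 => (abs_sub _ _).trans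
        (add_le_add (hbd s hsI _ (one_le_update_of_fvRate_ne_zero h0 hη)) (hbd s hsI _ hη))
    have hsum2 : ∀ i, Summable fun y => fvRate p N η i y *
        ((if ∀ j, 1 ≤ Function.update η i y j then
            cutoff N n (Function.update η i y) * Ψ s (Function.update η i y) else 0)
          - (if ∀ j, 1 ≤ η j then cutoff N n η * Ψ s η else 0)) := by
      have hb : ∀ ζ, |if ∀ j, 1 ≤ ζ j then cutoff N n ζ * Ψ s ζ else 0| ≤ A := by
        intro ζ
        split_ifs with hζ
        · rw [abs_mul, abs_of_nonneg (cutoff_nonneg N n ζ)]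
          exact (mul_le_of_le_one_left (abs_nonneg _) (cutoff_le_one N n ζ)).trans
            (hbd s hsI ζ hζ)
        · rwa [abs_zero]
      exact fun i => summable_fvRate_mul hp hN η i (A := A + A) fun y _ =>
        (abs_sub _ _).trans (add_le_add (hb _) (hb _))
    have h3 : ∑ i, ∑' y : ℕ, fvRate p N η i y *
        ((if ∀ j, 1 ≤ Function.update η i y j then
            cutoff N n (Function.update η i y) * Ψ s (Function.update η i y) else 0)
          - (if ∀ j, 1 ≤ η j then cutoff N n η * Ψ s η else 0))
        ≤ cutoff N n η * (∑ i, ∑' y, fvRate p N η i y * (Ψ s (Function.update η i y) - Ψ s η))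
          + A / (n + 1) * ∑ i, ∑' y : ℕ, fvRate p N η i y * (|(y : ℝ) - η i| + 1) := by
      rw [Finset.mul_sum, Finset.mul_sum, ← Finset.sum_add_distrib]
      refine Finset.sum_le_sum fun i _ => ?_
      rw [← tsum_mul_left, ← tsum_mul_left,
        ← ((hsum1 i).mul_left _).tsum_add (((hM η).1 i).mul_left _)]
      exact (hsum2 i).tsum_le_tsum (hterm i)
        (((hsum1 i).mul_left _).add (((hM η).1 i).mul_left _))
    have h4 := mul_le_mul_of_nonneg_left (hM η).2 (by positivity : 0 ≤ A / ((n : ℝ) + 1))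
    have h5 := mul_le_mul_of_nonneg_left hg (cutoff_nonneg N n η)
    have h6 := mul_le_mul_of_nonneg_right (cutoff_le_one N n η) hB
    calc _ ≤ cutoff N n η * B + A / (n + 1) * (M * ((∑ i, η i : ℕ) : ℝ)) := by linarith
      _ ≤ _ := by
        refine (add_le_add_left h6 _).trans (le_of_eq ?_)
        ring
  have hbound : ∀ n : ℕ,
      ∫ η, (if ∀ i, 1 ≤ η i then cutoff N n η * Ψ t η else 0) ∂K.P t ξ
        ≤ cutoff N n ξ * Ψ 0 ξ
          + (B + A * M * (Real.exp (M₁ * t) * ((∑ i, ξ i : ℕ) : ℝ)) * (1 / ((n : ℝ) + 1))) * t := by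
    intro n
    set D := B + A * M * (Real.exp (M₁ * t) * ((∑ i, ξ i : ℕ) : ℝ)) * (1 / ((n : ℝ) + 1)) with hD
    set T := confBox N (n + 1) with hT
    set G : ℝ → (Fin N → ℕ) → ℝ := fun s η =>
      if ∀ i, 1 ≤ η i then cutoff N n η * Ψ s η else 0 with hG
    set G' : ℝ → (Fin N → ℕ) → ℝ := fun s η =>
      if ∀ i, 1 ≤ η i then cutoff N n η * Ψ' s η else 0 with hG'
    have hG0 : ∀ u, ∀ η ∉ T, G u η = 0 := by
      intro u η hη
      simp [hG, cutoff_eq_zero (lt_sum_of_notMem_confBox hη).le]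
    have hG'0 : ∀ u, ∀ η ∉ T, G' u η = 0 := by
      intro u η hη
      simp [hG', cutoff_eq_zero (lt_sum_of_notMem_confBox hη).le]
    have hLG0 : ∀ s, ∀ η ∉ T, fvGen p N (G s) η = 0 := fun s η hη =>
      fvGen_eq_zero_of_lt_sum (n := n + 1) (c := 0)
        (fun ζ hζ => by simp [hG, cutoff_eq_zero hζ]) (lt_sum_of_notMem_confBox hη)
    have hGd : ∀ s ∈ Ico 0 t, HasDerivWithinAt (fun u => ∫ η, G u η ∂K.P u ξ)
        ((∫ η, G' s η ∂K.P s ξ) + ∫ η, fvGen p N (G s) η ∂K.P s ξ) (Ici s) s := by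
      intro s hs
      refine hasDerivWithinAt_integral_of_support hK ξ hs.1 hG0 (hG'0 s) fun η _ => ?_
      by_cases hη : ∀ i, 1 ≤ η i
      · simp only [hG, hG', if_pos hη]
        exact (hderiv s hs η hη).const_mul _
      · simp only [hG, hG', if_neg hη]
        exact hasDerivWithinAt_const _ _ _
    have hGc : ContinuousOn (fun u => ∫ η, G u η ∂K.P u ξ) (Icc 0 t) := by
      simp_rw [fun u => integral_eq_sum_of_support (μ := K.P u ξ) (hG0 u)]
      refine continuousOn_finsetSum _ fun z _ => ContinuousOn.mul (fun u hu => ?_) ?_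
      · exact ((hK (fun η => if η = z then (1 : ℝ) else 0)
          ⟨1, fun x => by dsimp only; split_ifs <;> norm_num⟩ Measurable.of_discrete ξ u
          hu.1).mono Icc_subset_Ici_self).continuousWithinAt
      · by_cases hz : ∀ i, 1 ≤ z i
        · simp only [hG, if_pos hz]
          exact continuousOn_const.mul (hcont z hz)
        · simp only [hG, if_neg hz]
          exact continuousOn_const
    have key := image_le_of_deriv_right_le_deriv_boundary hGc hGd
      (B := fun u => cutoff N n ξ * Ψ 0 ξ + D * u) (B' := fun _ => D)
      (by simp [integral_initial, hG, hξ])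
      (by fun_prop)
      (fun u _ => by
        have := ((hasDerivAt_id' u).const_mul D).const_add (cutoff N n ξ * Ψ 0 ξ)
        rw [mul_one] at this
        exact this.hasDerivWithinAt)
      (fun s hs => by
        have hi1 : Integrable (G' s) (K.P s ξ) :=
          integrable_of_abs_le (abs_le_sum_of_support (hG'0 s))
        have hi2 : Integrable (fvGen p N (G s)) (K.P s ξ) :=
          integrable_of_abs_le (abs_le_sum_of_support (hLG0 s))
        have hi3 : Integrable (fun η : Fin N → ℕ =>
            min ((∑ i, η i : ℕ) : ℝ) ((n + 1 : ℕ) : ℝ)) (K.P s ξ) :=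
          integrable_of_abs_le (A := ((n + 1 : ℕ) : ℝ)) fun η => by
            rw [abs_of_nonneg (le_min (Nat.cast_nonneg _) (Nat.cast_nonneg _))]
            exact min_le_right _ _
        rw [← integral_add hi1 hi2]
        refine (integral_mono (hi1.add hi2) ((integrable_const B).add
          (hi3.const_mul (A * M / (n + 1)))) (hgenG n s hs)).trans ?_
        rw [integral_add' (integrable_const B) (hi3.const_mul _), integral_const_mul]
        simp only [integral_const, probReal_univ, one_smul]
        have h1 : Real.exp (M₁ * s) ≤ Real.exp (M₁ * t) :=
          Real.exp_le_exp.2 (mul_le_mul_of_nonneg_left hs.2.le hM₁0)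
        have h2 := (hM₁ (n + 1) ξ s hs.1).trans
          (mul_le_mul_of_nonneg_right h1 (Nat.cast_nonneg (∑ i, ξ i)))
        have h3 := mul_le_mul_of_nonneg_left h2 (by positivity : 0 ≤ A * M / ((n : ℝ) + 1))
        calc _ ≤ _ := add_le_add_right h3 B
          _ = D := by rw [hD]; ring)
      (right_mem_Icc.2 ht)
    exact key
  have hlim1 : Tendsto (fun n : ℕ =>
      ∫ η, (if ∀ i, 1 ≤ η i then cutoff N n η * Ψ t η else 0) ∂K.P t ξ) atTop
      (𝓝 (∫ η, (if ∀ i, 1 ≤ η i then Ψ t η else 0) ∂K.P t ξ)) := by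
    refine tendsto_integral_of_dominated_convergence (fun _ => A)
      (fun n => Measurable.of_discrete.aestronglyMeasurable) (integrable_const A)
      (fun n => Eventually.of_forall fun η => ?_) (Eventually.of_forall fun η => ?_)
    · split_ifs with hη
      · rw [Real.norm_eq_abs, abs_mul, abs_of_nonneg (cutoff_nonneg N n η)]
        exact (mul_le_of_le_one_left (abs_nonneg _) (cutoff_le_one N n η)).trans
          (hbd t (right_mem_Icc.2 ht) η hη)
      · rwa [norm_zero]
    · split_ifs with hη
      · simpa using (tendsto_cutoff N η).mul_const (Ψ t η)
      · exact tendsto_const_nhds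
  have hlim2 : Tendsto (fun n : ℕ => cutoff N n ξ * Ψ 0 ξ
      + (B + A * M * (Real.exp (M₁ * t) * ((∑ i, ξ i : ℕ) : ℝ)) * (1 / ((n : ℝ) + 1))) * t) atTop
      (𝓝 (Ψ 0 ξ + B * t)) := by
    have h := ((tendsto_cutoff N ξ).mul_const (Ψ 0 ξ)).add
      (((tendsto_one_div_add_atTop_nhds_zero_nat.const_mul
        (A * M * (Real.exp (M₁ * t) * ((∑ i, ξ i : ℕ) : ℝ)))).const_add B).mul_const t)
    simpa only [one_mul, mul_zero, add_zero] using h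
  exact le_of_tendsto_of_tendsto' hlim1 hlim2 hbound

/-- Particles started from positive sites stay there. -/
theorem ae_one_le {p : ℕ → ℝ} {σ v : ℝ} (hp : OffspringLaw p σ v) {N : ℕ} (hN : 1 ≤ N)
    {K : MarkovSemigroup (Fin N → ℕ)} (hK : IsFVSemigroup p N K) {t : ℝ} (ht : 0 ≤ t)
    {ξ : Fin N → ℕ} (hξ : ∀ i, 1 ≤ ξ i) : ∀ᵐ η ∂K.P t ξ, ∀ i, 1 ≤ η i := by
  have := K.prob
  have h := fv_comparison hp hN hK ht (Ψ := fun _ _ => -1) (Ψ' := fun _ _ => 0) (A := 1) (B := 0)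
    le_rfl (by simp) (fun _ _ => continuousOn_const)
    (fun _ _ _ _ => hasDerivWithinAt_const _ _ _)
    (fun s _ η _ => by rw [fvGen_eq_zero fun _ _ _ => rfl, add_zero]) hξ
  set E : Set (Fin N → ℕ) := {η | ∀ i, 1 ≤ η i} with hE
  have hEm : MeasurableSet E := MeasurableSet.of_discrete
  have h1 : (fun η : Fin N → ℕ => if ∀ i, 1 ≤ η i then (-1 : ℝ) else 0)
      = E.indicator fun _ => (-1 : ℝ) := by
    funext η
    simp only [hE, Set.indicator_apply, Set.mem_ofPred_eq]
  rw [h1, integral_indicator_const _ hEm, smul_eq_mul] at h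
  have h2 : (K.P t ξ).real E = 1 := le_antisymm measureReal_le_one (by linarith)
  have h3 : (K.P t ξ) E = 1 := by
    rwa [measureReal_def, ENNReal.toReal_eq_one_iff] at h2
  exact (prob_compl_eq_zero_iff hEm).2 h3

/-- Galton-Watson generator read off from the jump rates. -/
def gwBack (p : ℕ → ℝ) (φ : ℕ → ℝ) (x : ℕ) : ℝ := ∑' z : ℕ, gwRate p x z * (φ z - φ x)

/-- A bounded solution of the Galton-Watson backward equation vanishing at the absorbing state. -/
structure IsKilledSolution (p : ℕ → ℝ) (g : ℝ → ℕ → ℝ) : Prop where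
  zero : ∀ r, 0 ≤ r → g r 0 = 0
  bound : ∀ r, 0 ≤ r → ∀ x, |g r x| ≤ 1
  deriv : ∀ r, 0 ≤ r → ∀ x, HasDerivWithinAt (fun s => g s x) (gwBack p (g r) x) (Ici 0) r

theorem summable_gwRate_mul {p : ℕ → ℝ} {σ v : ℝ} (hp : OffspringLaw p σ v) (x : ℕ)
    {φ : ℕ → ℝ} {A : ℝ} (hφ : ∀ y, |φ y| ≤ A) :
    Summable fun y => gwRate p x y * (φ y - φ x) := by
  refine Summable.of_norm_bounded ((summable_gwRate hp x).mul_right (A + A)) fun y => ?_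
  rw [Real.norm_eq_abs, abs_mul, abs_of_nonneg (gwRate_nonneg hp.nonneg x y)]
  exact mul_le_mul_of_nonneg_left ((abs_sub _ _).trans (add_le_add (hφ _) (hφ _)))
    (gwRate_nonneg hp.nonneg x y)

namespace GWTransition

variable {p : ℕ → ℝ} (G : GWTransition p)

theorem summable {t : ℝ} (ht : 0 ≤ t) (x : ℕ) : Summable fun y => G.pt t x y := by
  by_contra h
  have := G.total t x ht
  rw [tsum_eq_zero_of_not_summable h] at this
  exact zero_ne_one this

theorem le_one {t : ℝ} (ht : 0 ≤ t) (x y : ℕ) : G.pt t x y ≤ 1 := by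
  rw [← G.total t x ht]
  exact (G.summable ht x).le_tsum y fun z _ => G.nonneg t x z

theorem abs_le_one {t : ℝ} (ht : 0 ≤ t) (x y : ℕ) : |G.pt t x y| ≤ 1 := by
  rw [abs_of_nonneg (G.nonneg t x y)]
  exact G.le_one ht x y

theorem pt_zero_left {t : ℝ} (ht : 0 ≤ t) (y : ℕ) : G.pt t 0 y = if y = 0 then 1 else 0 := by
  have h : ∀ s, 0 ≤ s → HasDerivWithinAt (fun s => G.pt s 0 y) 0 (Ici 0) s := by
    intro s hs
    simpa [gwRate_of_zero] using G.backward 0 y s hs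
  rw [← G.init]
  exact constant_of_has_deriv_right_zero
    (fun s hs => ((h s hs.1).mono Icc_subset_Ici_self).continuousWithinAt)
    (fun s hs => (h s hs.1).mono (Ici_subset_Ici.2 hs.1)) t (right_mem_Icc.2 ht)

/-- Probability of non-absorption. -/
def survival (t : ℝ) (x : ℕ) : ℝ := 1 - G.pt t x 0

/-- Expectation of the finitely supported observable `f` restricted to `S`. -/
def expect (S : Finset ℕ) (f : ℕ → ℝ) (t : ℝ) (x : ℕ) : ℝ := ∑ y ∈ S, f y * G.pt t x y

theorem hasSum_survival {t : ℝ} (ht : 0 ≤ t) (x : ℕ) :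
    HasSum (fun y => if 1 ≤ y then G.pt t x y else 0) (G.survival t x) := by
  have h1 : HasSum (fun y => G.pt t x y) 1 := by
    rw [← G.total t x ht]
    exact (G.summable ht x).hasSum
  have h2 : HasSum (fun y => if y = 0 then G.pt t x 0 else 0) (G.pt t x 0) := by
    have := hasSum_single (f := fun y => if y = 0 then G.pt t x 0 else 0) 0
      (fun y hy => if_neg hy)
    simpa using this
  refine (h1.sub h2).congr_fun fun y => ?_
  rcases y with _ | y <;> simp

theorem survival_mem {t : ℝ} (ht : 0 ≤ t) (x : ℕ) :
    0 ≤ G.survival t x ∧ G.survival t x ≤ 1 := by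
  unfold survival
  exact ⟨by linarith [G.le_one ht x 0], by linarith [G.nonneg t x 0]⟩

theorem survival_zero {x : ℕ} (hx : 1 ≤ x) : G.survival 0 x = 1 := by
  unfold survival
  rw [G.init, if_neg (by omega), sub_zero]

theorem expect_zero (S : Finset ℕ) {f : ℕ → ℝ} (hf : ∀ y ∉ S, f y = 0) (x : ℕ) :
    G.expect S f 0 x = f x := by
  unfold expect
  simp only [G.init, mul_ite, mul_one, mul_zero, Finset.sum_ite_eq']
  split_ifs with h
  · rfl
  · exact (hf x h).symm

theorem abs_expect_le {S : Finset ℕ} (hS : 0 ∉ S) {f : ℕ → ℝ} (hf : ∀ y, |f y| ≤ 1) {t : ℝ}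
    (ht : 0 ≤ t) (x : ℕ) : |G.expect S f t x| ≤ G.survival t x := by
  unfold expect
  refine (Finset.abs_sum_le_sum_abs _ _).trans ?_
  rw [← (G.hasSum_survival ht x).tsum_eq]
  refine le_trans (Finset.sum_le_sum fun y hy => ?_)
    ((G.hasSum_survival ht x).summable.sum_le_tsum S fun y _ => ?_)
  · have hy1 : 1 ≤ y := Nat.one_le_iff_ne_zero.2 fun h => hS (h ▸ hy)
    rw [if_pos hy1, abs_mul, abs_of_nonneg (G.nonneg t x y)]
    exact mul_le_of_le_one_left (G.nonneg t x y) (hf y)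
  · split_ifs
    · exact G.nonneg t x y
    · exact le_rfl

theorem isKilledSolution_survival : IsKilledSolution p G.survival where
  zero r hr := by simp [survival, G.pt_zero_left hr]
  bound r hr x := by
    rw [abs_of_nonneg (G.survival_mem hr x).1]
    exact (G.survival_mem hr x).2
  deriv r hr x := by
    have h := (G.backward x 0 r hr).const_sub 1
    refine h.congr_deriv ?_
    unfold gwBack survival
    rw [← tsum_neg]
    exact tsum_congr fun z => by ring

theorem isKilledSolution_expect {σ v : ℝ} (hp : OffspringLaw p σ v) {S : Finset ℕ} (hS : 0 ∉ S)
    {f : ℕ → ℝ} (hf : ∀ y, |f y| ≤ 1) : IsKilledSolution p (G.expect S f) where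
  zero r hr := by
    refine Finset.sum_eq_zero fun y hy => ?_
    rw [G.pt_zero_left hr, if_neg (fun h : y = 0 => hS (h ▸ hy)), mul_zero]
  bound r hr x := (G.abs_expect_le hS hf hr x).trans (G.survival_mem hr x).2
  deriv r hr x := by
    have h := HasDerivWithinAt.fun_sum (u := S) fun y _ => (G.backward x y r hr).const_mul (f y)
    refine h.congr_deriv ?_
    unfold gwBack expect
    simp_rw [← tsum_mul_left]
    rw [← Summable.tsum_finsetSum]
    · refine tsum_congr fun z => ?_
      rw [← Finset.sum_sub_distrib, Finset.mul_sum]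
      exact Finset.sum_congr rfl fun y _ => by ring
    · exact fun y _ => (summable_gwRate_mul hp x fun z => G.abs_le_one hr z y).mul_left _

end GWTransition

theorem IsKilledSolution.hasDerivAt_reverse {p : ℕ → ℝ} {g : ℝ → ℕ → ℝ}
    (hg : IsKilledSolution p g) {t s : ℝ} (hs : s ∈ Ico 0 t) (x : ℕ) :
    HasDerivAt (fun s => g (t - s) x) (-gwBack p (g (t - s)) x) s := by
  have h0 : 0 < t - s := sub_pos.2 hs.2
  have h1 : HasDerivAt (fun r => g r x) (gwBack p (g (t - s)) x) (t - s) :=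
    (hg.deriv _ h0.le x).hasDerivAt (Ici_mem_nhds h0)
  exact h1.comp_const_sub t s

theorem IsKilledSolution.continuousOn_reverse {p : ℕ → ℝ} {g : ℝ → ℕ → ℝ}
    (hg : IsKilledSolution p g) (t : ℝ) (x : ℕ) :
    ContinuousOn (fun s => g (t - s) x) (Icc 0 t) := by
  have h : ContinuousOn (fun r => g r x) (Ici 0) := fun r hr =>
    (hg.deriv r hr x).continuousWithinAt
  exact h.comp (by fun_prop) fun s hs => sub_nonneg.2 hs.2

/-- Action of the one-particle Fleming-Viot jumps on an observable vanishing at zero. -/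
theorem tsum_fvRate_mul {p : ℕ → ℝ} {σ v : ℝ} (hp : OffspringLaw p σ v) {N : ℕ} (hN : 1 ≤ N)
    {g : ℕ → ℝ} (hg0 : g 0 = 0) {A : ℝ} (hg : ∀ y, |g y| ≤ A) {η : Fin N → ℕ}
    (hη : ∀ i, 1 ≤ η i) (i : Fin N) :
    ∑' y, fvRate p N η i y * (g y - g (η i))
      = gwBack p g (η i) + gwRate p (η i) 0 *
        (g (η i) + (N : ℝ) / ((N : ℝ) - 1) * (empMean N g η - g (η i))) := by
  have hNpos : (0 : ℝ) < N := by exact_mod_cast hN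
  have h1 := (summable_gwRate_mul hp (η i) hg).hasSum
  have h2 := (hasSum_emp_mul N (fun y => g y - g (η i)) η).mul_left
    (gwRate p (η i) 0 * ((N : ℝ) / ((N : ℝ) - 1)))
  have h3 : HasSum (fun y => if y = 0 then gwRate p (η i) 0 * (g 0 - g (η i)) else 0)
      (gwRate p (η i) 0 * (g 0 - g (η i))) := by
    have := hasSum_single
      (f := fun y => if y = 0 then gwRate p (η i) 0 * (g 0 - g (η i)) else 0) 0
      (fun y hy => if_neg hy)
    simpa using this
  have h4 : empMean N (fun y => g y - g (η i)) η = empMean N g η - g (η i) := by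
    unfold empMean
    rw [Finset.sum_sub_distrib]
    simp only [Finset.sum_const, Finset.card_univ, Fintype.card_fin, nsmul_eq_mul]
    field_simp
  have h5 : HasSum (fun y => fvRate p N η i y * (g y - g (η i))) _ :=
    ((h1.add h2).sub h3).congr_fun fun y => by
      rcases y with _ | y
      · simp [fvRate, emp_zero hη]
      · simp only [fvRate, Nat.le_add_left, if_true, Nat.succ_ne_zero, if_false]
        ring
  rw [h5.tsum_eq, h4, hg0]
  unfold gwBack
  ring

/-- The survival probability decays at most at the absorption rate. -/
theorem exp_neg_le_survival {p : ℕ → ℝ} {σ v : ℝ} (hp : OffspringLaw p σ v)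
    (G : GWTransition p) {K : MarkovSemigroup (Fin 1 → ℕ)} (hK : IsFVSemigroup p 1 K) {t : ℝ}
    (ht : 0 ≤ t) {x : ℕ} (hx : 1 ≤ x) : Real.exp (-p 0 * t) ≤ G.survival t x := by
  have := K.prob
  have hG := G.isKilledSolution_survival
  have hexp : ∀ u : ℝ, HasDerivAt (fun u => Real.exp (-p 0 * u))
      (-p 0 * Real.exp (-p 0 * u)) u := by
    intro u
    have h := ((hasDerivAt_id' u).const_mul (-p 0)).exp
    rwa [mul_one, mul_comm] at h
  have key := fv_comparison hp le_rfl hK ht (A := 1) (B := 0)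
    (Ψ := fun s η => Real.exp (-p 0 * s) * G.survival (t - s) (η 0))
    (Ψ' := fun s η => -p 0 * Real.exp (-p 0 * s) * G.survival (t - s) (η 0)
      + Real.exp (-p 0 * s) * -gwBack p (G.survival (t - s)) (η 0)) le_rfl
    (fun s hs η _ => by
      rw [abs_mul, abs_of_pos (Real.exp_pos _)]
      refine mul_le_one₀ (Real.exp_le_one_iff.2 ?_) (abs_nonneg _)
        (hG.bound _ (sub_nonneg.2 hs.2) _)
      exact mul_nonpos_of_nonpos_of_nonneg (neg_nonpos.2 (hp.nonneg 0)) hs.1)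
    (fun η _ => ContinuousOn.mul (by fun_prop) (hG.continuousOn_reverse t _))
    (fun s hs η _ => ((hexp s).mul (hG.hasDerivAt_reverse hs (η 0))).hasDerivWithinAt)
    (fun s hs η hη => by
      have hs' : 0 ≤ t - s := sub_nonneg.2 hs.2.le
      have h := tsum_fvRate_mul hp le_rfl (hG.zero _ hs') (hG.bound _ hs') hη 0
      rw [fvGen_eq, Fin.sum_univ_one]
      simp only [Function.update_self]
      simp_rw [← mul_sub, mul_left_comm _ (Real.exp _), tsum_mul_left]
      rw [h, Nat.cast_one, sub_self, div_zero, zero_mul, add_zero]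
      have h1 : gwRate p (η 0) 0 ≤ p 0 := by
        rw [gwRate_to_zero]
        split_ifs
        · exact le_rfl
        · exact hp.nonneg 0
      have h2 := mul_nonneg (mul_nonneg (sub_nonneg.2 h1) (Real.exp_pos (-p 0 * s)).le)
        (G.survival_mem hs' (η 0)).1
      nlinarith)
    (ξ := fun _ => x) (fun _ => hx)
  have hae : ∫ η : Fin 1 → ℕ, (if ∀ i, 1 ≤ η i then
      Real.exp (-p 0 * t) * G.survival (t - t) (η 0) else 0) ∂K.P t (fun _ => x)
      = Real.exp (-p 0 * t) := by
    rw [integral_congr_ae (g := fun _ => Real.exp (-p 0 * t))]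
    · simp
    filter_upwards [ae_one_le hp le_rfl hK ht (ξ := fun _ => x) fun _ => hx] with η hη
    rw [if_pos hη, sub_self, G.survival_zero (hη 0), mul_one]
  rw [hae] at key
  simpa using key

set_option maxHeartbeats 1000000 in
theorem jump_quotient_le {α κ β a b a' b' : ℝ} (hα : 0 ≤ α) (hα1 : α ≤ 1) (hκ : |κ| ≤ 2)
    (hβ : 0 < β) (hab : |a| ≤ b) (hb : β ≤ b) (hb' : β ≤ b') :
    (α * (a' / b') ^ 2 + κ * (a' / b')) - (α * (a / b) ^ 2 + κ * (a / b))
      ≤ (2 * α * (a / b) + κ) / b * ((a' - a) - a / b * (b' - b))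
        + 8 / β ^ 2 * ((a' - a) ^ 2 + (b' - b) ^ 2) := by
  have hb0 : 0 < b := hβ.trans_le hb
  have hb0' : 0 < b' := hβ.trans_le hb'
  set F := a / b with hF
  set D := (a' - a) - F * (b' - b) with hD
  set θ := 2 * α * F + κ with hθ
  have ha : a = F * b := by rw [hF]; field_simp
  clear_value F D θ
  have hF1 : |F| ≤ 1 := by
    rw [hF, abs_div, abs_of_pos hb0]
    exact (div_le_one hb0).2 hab
  obtain ⟨hF2, hF3⟩ := abs_le.1 hF1
  have hF' : a' / b' = F + D / b' := by
    rw [hD]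
    field_simp
    linarith
  have hθ4 : |θ| ≤ 4 := by
    obtain ⟨h1, h2⟩ := abs_le.1 hκ
    rw [abs_le]
    constructor <;> nlinarith
  have hD2 : D ^ 2 ≤ 2 * ((a' - a) ^ 2 + (b' - b) ^ 2) := by
    have h1 : F ^ 2 ≤ 1 := by nlinarith
    have h2 : D ^ 2 ≤ 2 * (a' - a) ^ 2 + 2 * (F ^ 2 * (b' - b) ^ 2) := by
      rw [hD]
      nlinarith [sq_nonneg ((a' - a) + F * (b' - b))]
    nlinarith [mul_le_mul_of_nonneg_right h1 (sq_nonneg (b' - b))]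
  have hinv : (b * b')⁻¹ ≤ (β ^ 2)⁻¹ := by
    rw [sq]
    gcongr
  have hinv' : (b' ^ 2)⁻¹ ≤ (β ^ 2)⁻¹ := by gcongr
  have hcross : -(θ * D * (b' - b)) ≤ 2 * (D ^ 2 + (b' - b) ^ 2) := by
    have h1 : -(θ * D * (b' - b)) ≤ |θ| * (|D| * |b' - b|) := by
      rw [← abs_mul, ← abs_mul, ← mul_assoc]
      exact neg_le_abs _
    have h2 : |D| * |b' - b| ≤ (D ^ 2 + (b' - b) ^ 2) / 2 := by
      rw [← sq_abs D, ← sq_abs (b' - b)]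
      nlinarith [sq_nonneg (|D| - |b' - b|)]
    have h3 : 0 ≤ |D| * |b' - b| := by positivity
    nlinarith
  rw [hF']
  have hexpand : (α * (F + D / b') ^ 2 + κ * (F + D / b')) - (α * F ^ 2 + κ * F)
      = θ / b * D + -(θ * D * (b' - b)) * (b * b')⁻¹ + α * D ^ 2 * (b' ^ 2)⁻¹ := by
    rw [hθ]
    field_simp
    ring
  rw [hexpand]
  have h1 : -(θ * D * (b' - b)) * (b * b')⁻¹ ≤ 2 * (D ^ 2 + (b' - b) ^ 2) * (β ^ 2)⁻¹ :=
    (mul_le_mul_of_nonneg_right hcross (by positivity)).trans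
      (mul_le_mul_of_nonneg_left hinv (by positivity))
  have h2 : α * D ^ 2 * (b' ^ 2)⁻¹ ≤ D ^ 2 * (β ^ 2)⁻¹ :=
    mul_le_mul (mul_le_of_le_one_left (sq_nonneg _) hα1) hinv' (by positivity) (sq_nonneg _)
  have h3 : (3 * D ^ 2 + 2 * (b' - b) ^ 2) * (β ^ 2)⁻¹
      ≤ (8 * ((a' - a) ^ 2 + (b' - b) ^ 2)) * (β ^ 2)⁻¹ :=
    mul_le_mul_of_nonneg_right (by nlinarith [sq_nonneg (a' - a)]) (by positivity)
  calc _ ≤ θ / b * D + ((3 * D ^ 2 + 2 * (b' - b) ^ 2) * (β ^ 2)⁻¹) := by linarith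
    _ ≤ θ / b * D + (8 * ((a' - a) ^ 2 + (b' - b) ^ 2)) * (β ^ 2)⁻¹ := by linarith
    _ = _ := by ring

/-- Contribution of one absorption-and-resampling channel to the corrected generator. -/
theorem resampling_term_le {N α κ β a b ρ q g h : ℝ} (hN : 1 ≤ N) (hα : 0 ≤ α) (hα1 : α ≤ 1)
    (hκ : |κ| ≤ 2) (hβ : 0 < β) (hβ1 : β ≤ 1) (hab : |a| ≤ b) (hb : β ≤ b) (hb1 : b ≤ 1)
    (hρ0 : 0 ≤ ρ) (hρ2 : ρ ≤ 2) (hρ : |1 - ρ| ≤ 2 / N) (hq0 : 0 ≤ q) (hq1 : q ≤ 1)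
    (hg : |g| ≤ 1) (hh : |h| ≤ 1) :
    ((2 * α * (a / b) + κ) / (b * N) - 2 * (8 / β ^ 2) * g / N ^ 2) * (q * (g + ρ * (a - g)))
      + (-((2 * α * (a / b) + κ) * (a / b)) / (b * N) - 2 * (8 / β ^ 2) * h / N ^ 2)
        * (q * (h + ρ * (b - h)))
      ≤ 176 / β ^ 2 / N ^ 2 := by
  have hb0 : 0 < b := hβ.trans_le hb
  have hN0 : 0 < N := by linarith
  set F := a / b with hF
  have ha : a = F * b := by rw [hF]; field_simp
  have hF1 : |F| ≤ 1 := by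
    rw [hF, abs_div, abs_of_pos hb0]
    exact (div_le_one hb0).2 hab
  set θ := 2 * α * F + κ with hθ
  have hθ4 : |θ| ≤ 4 := by
    obtain ⟨h1, h2⟩ := abs_le.1 hκ
    obtain ⟨hF2, hF3⟩ := abs_le.1 hF1
    rw [abs_le]
    constructor <;> nlinarith
  have hE : ∀ u c : ℝ, |u| ≤ 1 → |c| ≤ 1 → |u * (u + ρ * (c - u))| ≤ 5 := by
    intro u c hu hc
    have h1 : |c - u| ≤ 2 := (abs_sub _ _).trans (by linarith)
    have h2 : |ρ * (c - u)| ≤ 2 * 2 := by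
      rw [abs_mul, abs_of_nonneg hρ0]
      exact mul_le_mul hρ2 h1 (abs_nonneg _) (by norm_num)
    have h3 : |u + ρ * (c - u)| ≤ 5 := (abs_add_le _ _).trans (by linarith)
    rw [abs_mul]
    calc _ ≤ 1 * 5 := mul_le_mul hu h3 (abs_nonneg _) (by norm_num)
      _ = 5 := by norm_num
  have e1 := (abs_le.1 (hE g a hg (hab.trans hb1))).1
  have e2 := (abs_le.1 (hE h b hh (by rwa [abs_of_pos hb0]))).1
  have hsplit : (θ / (b * N) - 2 * (8 / β ^ 2) * g / N ^ 2) * (q * (g + ρ * (a - g)))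
      + (-(θ * F) / (b * N) - 2 * (8 / β ^ 2) * h / N ^ 2) * (q * (h + ρ * (b - h)))
      = q * (θ * ((1 - ρ) * (g - F * h)) / (b * N)
        + 16 / β ^ 2 / N ^ 2 * (-(g * (g + ρ * (a - g))) + -(h * (h + ρ * (b - h))))) := by
    rw [ha]
    field_simp
    ring
  rw [hsplit]
  have h1 : θ * ((1 - ρ) * (g - F * h)) / (b * N) ≤ 16 / β ^ 2 / N ^ 2 := by
    have h2 : |g - F * h| ≤ 2 := by
      refine (abs_sub _ _).trans ?_
      rw [abs_mul]
      have := mul_le_one₀ hF1 (abs_nonneg h) hh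
      linarith
    have h3 : |θ * ((1 - ρ) * (g - F * h))| ≤ 4 * (2 / N * 2) := by
      rw [abs_mul, abs_mul]
      exact mul_le_mul hθ4 (mul_le_mul hρ h2 (abs_nonneg _) (by positivity)) (by positivity)
        (by norm_num)
    have h4 : (b)⁻¹ ≤ (β ^ 2)⁻¹ := by
      refine inv_anti₀ (by positivity) ?_
      nlinarith
    calc θ * ((1 - ρ) * (g - F * h)) / (b * N)
        ≤ 4 * (2 / N * 2) / (b * N) :=
          div_le_div_of_nonneg_right ((le_abs_self _).trans h3) (by positivity)
      _ = 16 / N ^ 2 * b⁻¹ := by field_simp; norm_num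
      _ ≤ 16 / N ^ 2 * (β ^ 2)⁻¹ := mul_le_mul_of_nonneg_left h4 (by positivity)
      _ = _ := by field_simp
  have h5 : 16 / β ^ 2 / N ^ 2 * (-(g * (g + ρ * (a - g))) + -(h * (h + ρ * (b - h))))
      ≤ 16 / β ^ 2 / N ^ 2 * 10 := mul_le_mul_of_nonneg_left (by linarith) (by positivity)
  have h6 : (0 : ℝ) ≤ 176 / β ^ 2 / N ^ 2 := by positivity
  calc _ ≤ q * (176 / β ^ 2 / N ^ 2) := by
        refine mul_le_mul_of_nonneg_left ?_ hq0
        calc _ ≤ 16 / β ^ 2 / N ^ 2 + 16 / β ^ 2 / N ^ 2 * 10 := add_le_add h1 h5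
          _ = _ := by ring
    _ ≤ _ := mul_le_of_le_one_left h6 hq1

theorem empMean_mono {N : ℕ} {φ ψ : ℕ → ℝ} {η : Fin N → ℕ} (h : ∀ i, φ (η i) ≤ ψ (η i)) :
    empMean N φ η ≤ empMean N ψ η :=
  mul_le_mul_of_nonneg_left (Finset.sum_le_sum fun i _ => h i) (by positivity)

theorem empMean_const {N : ℕ} (hN : 1 ≤ N) (c : ℝ) (η : Fin N → ℕ) :
    empMean N (fun _ => c) η = c := by
  have hNpos : (0 : ℝ) < N := by exact_mod_cast hN
  unfold empMean
  simp only [Finset.sum_const, Finset.card_univ, Fintype.card_fin, nsmul_eq_mul]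
  field_simp

theorem abs_empMean_le {N : ℕ} {φ ψ : ℕ → ℝ} {η : Fin N → ℕ}
    (h : ∀ i, |φ (η i)| ≤ ψ (η i)) : |empMean N φ η| ≤ empMean N ψ η := by
  unfold empMean
  rw [abs_mul, abs_of_nonneg (by positivity : 0 ≤ (N : ℝ)⁻¹)]
  exact mul_le_mul_of_nonneg_left
    ((Finset.abs_sum_le_sum_abs _ _).trans (Finset.sum_le_sum fun i _ => h i)) (by positivity)

theorem abs_one_sub_div_sub_one_le {N : ℕ} (hN : 1 ≤ N) :
    |1 - (N : ℝ) / ((N : ℝ) - 1)| ≤ 2 / N := by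
  rcases hN.eq_or_lt with rfl | h
  · norm_num
  have h2 : (2 : ℝ) ≤ N := by exact_mod_cast h
  have h1 : 1 - (N : ℝ) / ((N : ℝ) - 1) = -(1 / ((N : ℝ) - 1)) := by
    have : (N : ℝ) - 1 ≠ 0 := by linarith
    field_simp
    ring
  rw [h1, abs_neg, abs_of_nonneg (div_nonneg zero_le_one (by linarith)),
    div_le_div_iff₀ (by linarith) (by linarith)]
  linarith

/-- The corrected observable: a quadratic function of the conditioned expectation, minus the
empirical second moments that compensate the quadratic variation. -/
def corrected (N : ℕ) (α κ c : ℝ) (g h : ℕ → ℝ) (η : Fin N → ℕ) : ℝ :=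
  α * (empMean N g η / empMean N h η) ^ 2 + κ * (empMean N g η / empMean N h η)
    - c / N * (empMean N (fun x => g x ^ 2) η + empMean N (fun x => h x ^ 2) η)

/-- The derivative of `corrected` along curves with velocities `g'` and `h'`. -/
def correctedDeriv (N : ℕ) (α κ c : ℝ) (g h g' h' : ℕ → ℝ) (η : Fin N → ℕ) : ℝ :=
  (2 * α * (empMean N g η / empMean N h η) + κ) / empMean N h η
      * (empMean N g' η - empMean N g η / empMean N h η * empMean N h' η)
    - c / N * (empMean N (fun x => 2 * g x * g' x) η + empMean N (fun x => 2 * h x * h' x) η)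

theorem hasDerivAt_empMean {N : ℕ} {η : Fin N → ℕ} {u : ℝ → ℕ → ℝ} {u' : ℕ → ℝ} {s : ℝ}
    (hu : ∀ x, HasDerivAt (fun s => u s x) (u' x) s) :
    HasDerivAt (fun s => empMean N (u s) η) (empMean N u' η) s := by
  unfold empMean
  exact (HasDerivAt.fun_sum fun i _ => hu (η i)).const_mul _

theorem hasDerivAt_corrected {N : ℕ} {α κ c : ℝ} {η : Fin N → ℕ} {u w : ℝ → ℕ → ℝ}
    {u' w' : ℕ → ℝ} {s : ℝ} (hu : ∀ x, HasDerivAt (fun s => u s x) (u' x) s)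
    (hw : ∀ x, HasDerivAt (fun s => w s x) (w' x) s) (hb : empMean N (w s) η ≠ 0) :
    HasDerivAt (fun s => corrected N α κ c (u s) (w s) η)
      (correctedDeriv N α κ c (u s) (w s) u' w' η) s := by
  have hsq : ∀ {z : ℝ → ℕ → ℝ} {z' : ℕ → ℝ}, (∀ x, HasDerivAt (fun s => z s x) (z' x) s) →
      HasDerivAt (fun s => empMean N (fun x => z s x ^ 2) η)
        (empMean N (fun x => 2 * z s x * z' x) η) s := fun hz =>
    hasDerivAt_empMean fun x => by simpa using (hz x).fun_pow 2
  have hF := (hasDerivAt_empMean (η := η) hu).fun_div (hasDerivAt_empMean (η := η) hw) hb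
  have key := (((hF.fun_pow 2).const_mul α).fun_add (hF.const_mul κ)).fun_sub
    (((hsq hu).fun_add (hsq hw)).const_mul (c / N))
  refine key.congr_deriv ?_
  unfold correctedDeriv
  push_cast
  field_simp

theorem continuousOn_corrected {N : ℕ} {α κ c : ℝ} {η : Fin N → ℕ} {u w : ℝ → ℕ → ℝ}
    {I : Set ℝ} (hu : ∀ x, ContinuousOn (fun s => u s x) I)
    (hw : ∀ x, ContinuousOn (fun s => w s x) I) (hb : ∀ s ∈ I, empMean N (w s) η ≠ 0) :
    ContinuousOn (fun s => corrected N α κ c (u s) (w s) η) I := by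
  have hF : ContinuousOn (fun s => empMean N (u s) η / empMean N (w s) η) I := by
    refine ContinuousOn.div ?_ ?_ hb <;> unfold empMean <;> fun_prop
  have hsq : ∀ {z : ℝ → ℕ → ℝ}, (∀ x, ContinuousOn (fun s => z s x) I) →
      ContinuousOn (fun s => empMean N (fun x => z s x ^ 2) η) I := fun hz => by
    unfold empMean
    fun_prop
  exact ((continuousOn_const.mul (hF.pow 2)).add (continuousOn_const.mul hF)).sub
    (continuousOn_const.mul ((hsq hu).add (hsq hw)))

theorem abs_empMean_div_le_one {N : ℕ} {g h : ℕ → ℝ} {η : Fin N → ℕ}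
    (hgh : ∀ y, |g y| ≤ h y) : |empMean N g η / empMean N h η| ≤ 1 := by
  have h1 := abs_empMean_le (N := N) (η := η) fun i => hgh (η i)
  have h0 : 0 ≤ empMean N h η := (abs_nonneg _).trans h1
  rw [abs_div, abs_of_nonneg h0]
  exact div_le_one_of_le₀ h1 h0

theorem empMean_sq_mem {N : ℕ} (hN : 1 ≤ N) {g : ℕ → ℝ} (hg : ∀ y, |g y| ≤ 1)
    (η : Fin N → ℕ) :
    0 ≤ empMean N (fun x => g x ^ 2) η ∧ empMean N (fun x => g x ^ 2) η ≤ 1 := by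
  constructor
  · unfold empMean
    positivity
  · rw [← empMean_const hN 1 η]
    exact empMean_mono fun i => (sq_le_one_iff_abs_le_one _).2 (hg _)

theorem abs_corrected_sub_le {N : ℕ} (hN : 1 ≤ N) {α κ c : ℝ} (hc : 0 ≤ c) {g h : ℕ → ℝ}
    (hgh : ∀ y, |g y| ≤ h y) (hh1 : ∀ y, h y ≤ 1) (η : Fin N → ℕ) :
    0 ≤ α * (empMean N g η / empMean N h η) ^ 2 + κ * (empMean N g η / empMean N h η)
        - corrected N α κ c g h η ∧
      α * (empMean N g η / empMean N h η) ^ 2 + κ * (empMean N g η / empMean N h η)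
        - corrected N α κ c g h η ≤ c / N * 2 := by
  obtain ⟨h1, h2⟩ := empMean_sq_mem hN (fun y => (hgh y).trans (hh1 y)) η
  obtain ⟨h3, h4⟩ := empMean_sq_mem hN (g := h) (fun y => by
    rw [abs_of_nonneg ((abs_nonneg _).trans (hgh y))]; exact hh1 y) η
  have hcN : 0 ≤ c / N := by positivity
  unfold corrected
  constructor
  · linarith [mul_nonneg hcN (add_nonneg h1 h3)]
  · linarith [mul_le_mul_of_nonneg_left (add_le_add h2 h4) hcN]

theorem abs_corrected_le {N : ℕ} (hN : 1 ≤ N) {α κ c : ℝ} (hα : 0 ≤ α) (hα1 : α ≤ 1)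
    (hκ : |κ| ≤ 2) (hc : 0 ≤ c) {g h : ℕ → ℝ}
    (hgh : ∀ y, |g y| ≤ h y) (hh1 : ∀ y, h y ≤ 1) (η : Fin N → ℕ) :
    |corrected N α κ c g h η| ≤ 3 + c / N * 2 := by
  obtain ⟨h1, h2⟩ := abs_corrected_sub_le (α := α) (κ := κ) hN hc hgh hh1 η
  have hF := abs_empMean_div_le_one (η := η) hgh
  set F := empMean N g η / empMean N h η
  have h3 : |κ * F| ≤ 2 * 1 := by
    rw [abs_mul]
    exact mul_le_mul hκ hF (abs_nonneg _) (by norm_num)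
  have h4 : F ^ 2 ≤ 1 := (sq_le_one_iff_abs_le_one _).2 hF
  have h5 : 0 ≤ α * F ^ 2 := by positivity
  have h6 : α * F ^ 2 ≤ 1 := mul_le_one₀ hα1 (sq_nonneg _) h4
  have h7 := abs_le.1 h3
  rw [abs_le]
  constructor <;> linarith

theorem corrected_update_sub_le {N : ℕ} (hN : 1 ≤ N) {α κ β : ℝ} (hα : 0 ≤ α) (hα1 : α ≤ 1)
    (hκ : |κ| ≤ 2) (hβ : 0 < β) {g h : ℕ → ℝ} (hgh : ∀ y, |g y| ≤ h y) {η : Fin N → ℕ}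
    {i : Fin N} {y : ℕ} (hb : β ≤ empMean N h η)
    (hb' : β ≤ empMean N h (Function.update η i y)) :
    corrected N α κ (8 / β ^ 2) g h (Function.update η i y) - corrected N α κ (8 / β ^ 2) g h η
      ≤ ((2 * α * (empMean N g η / empMean N h η) + κ) / (empMean N h η * N)
            - 2 * (8 / β ^ 2) * g (η i) / N ^ 2) * (g y - g (η i))
        + (-((2 * α * (empMean N g η / empMean N h η) + κ) * (empMean N g η / empMean N h η))
              / (empMean N h η * N)
            - 2 * (8 / β ^ 2) * h (η i) / N ^ 2) * (h y - h (η i)) := by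
  have hN0 : (N : ℝ) ≠ 0 := by positivity
  have hj := jump_quotient_le hα hα1 hκ hβ (abs_empMean_le fun i => hgh (η i)) hb hb'
    (a' := empMean N g (Function.update η i y))
  have hb0 : empMean N h η ≠ 0 := (hβ.trans_le hb).ne'
  unfold corrected
  have e1 : empMean N g (Function.update η i y) - empMean N g η
      = (N : ℝ)⁻¹ * (g y - g (η i)) := by rw [empMean_update]; ring
  have e2 : empMean N h (Function.update η i y) - empMean N h η
      = (N : ℝ)⁻¹ * (h y - h (η i)) := by rw [empMean_update]; ring
  rw [e1, e2] at hj
  rw [empMean_update N (fun x => g x ^ 2), empMean_update N (fun x => h x ^ 2)]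
  generalize empMean N g (Function.update η i y) / empMean N h (Function.update η i y) = F'
    at hj ⊢
  generalize empMean N g η / empMean N h η = F at hj ⊢
  generalize empMean N h η = b at hj hb0 ⊢
  generalize 8 / β ^ 2 = c at hj ⊢
  generalize 2 * α * F + κ = θ at hj ⊢
  generalize g y = gy at hj ⊢
  generalize g (η i) = gi at hj ⊢
  generalize h y = hy at hj ⊢
  generalize h (η i) = hi at hj ⊢
  have key : θ / b * ((N : ℝ)⁻¹ * (gy - gi) - F * ((N : ℝ)⁻¹ * (hy - hi)))
        + c * (((N : ℝ)⁻¹ * (gy - gi)) ^ 2 + ((N : ℝ)⁻¹ * (hy - hi)) ^ 2)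
        - c / N * ((N : ℝ)⁻¹ * (gy ^ 2 - gi ^ 2) + (N : ℝ)⁻¹ * (hy ^ 2 - hi ^ 2))
      = (θ / (b * N) - 2 * c * gi / N ^ 2) * (gy - gi)
        + (-(θ * F) / (b * N) - 2 * c * hi / N ^ 2) * (hy - hi) := by
    field_simp
    ring
  linarith

theorem correctedDeriv_eq_sum {N : ℕ} (α κ c : ℝ) (g h g' h' : ℕ → ℝ)
    (η : Fin N → ℕ) :
    correctedDeriv N α κ c g h g' h' η
      = ∑ i, (((2 * α * (empMean N g η / empMean N h η) + κ) / (empMean N h η * N)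
            - 2 * c * g (η i) / N ^ 2) * g' (η i)
        + (-((2 * α * (empMean N g η / empMean N h η) + κ) * (empMean N g η / empMean N h η))
              / (empMean N h η * N)
            - 2 * c * h (η i) / N ^ 2) * h' (η i)) := by
  unfold correctedDeriv
  generalize empMean N g η / empMean N h η = F
  generalize empMean N h η = b
  generalize 2 * α * F + κ = θ
  unfold empMean
  simp only [Finset.mul_sum, ← Finset.sum_add_distrib, ← Finset.sum_sub_distrib]
  refine Finset.sum_congr rfl fun i _ => ?_
  simp only [div_eq_mul_inv, mul_inv]
  ring

theorem correctedDeriv_add_fvGen_le {p : ℕ → ℝ} {σ v : ℝ} (hp : OffspringLaw p σ v) {N : ℕ}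
    (hN : 1 ≤ N) {α κ β : ℝ} (hα : 0 ≤ α) (hα1 : α ≤ 1) (hκ : |κ| ≤ 2) (hβ : 0 < β)
    {g h : ℕ → ℝ} (hg0 : g 0 = 0) (hh0 : h 0 = 0) (hgh : ∀ y, |g y| ≤ h y)
    (hh1 : ∀ y, h y ≤ 1) (hβh : ∀ y, 1 ≤ y → β ≤ h y) {η : Fin N → ℕ} (hη : ∀ i, 1 ≤ η i) :
    correctedDeriv N α κ (8 / β ^ 2) g h (fun x => -gwBack p g x) (fun x => -gwBack p h x) η
      + fvGen p N (corrected N α κ (8 / β ^ 2) g h) η ≤ 176 / β ^ 2 / N := by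
  have hN1 : (1 : ℝ) ≤ N := by exact_mod_cast hN
  have hg1 : ∀ y, |g y| ≤ 1 := fun y => (hgh y).trans (hh1 y)
  have hha : ∀ y, |h y| ≤ 1 := fun y => by
    rw [abs_of_nonneg ((abs_nonneg _).trans (hgh y))]; exact hh1 y
  have hmean : ∀ {ζ : Fin N → ℕ}, (∀ i, 1 ≤ ζ i) → β ≤ empMean N h ζ := fun {ζ} hζ => by
    rw [← empMean_const hN β ζ]
    exact empMean_mono fun i => hβh _ (hζ i)
  have hb1 : empMean N h η ≤ 1 := by
    rw [← empMean_const hN 1 η]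
    exact empMean_mono fun i => hh1 _
  have hβ1 : β ≤ 1 := (hmean hη).trans hb1
  have hab : |empMean N g η| ≤ empMean N h η := abs_empMean_le fun i => hgh (η i)
  obtain ⟨hρ0, hρ2⟩ := div_sub_one_mem hN
  rw [correctedDeriv_eq_sum, fvGen_eq, ← Finset.sum_add_distrib]
  have hterm : ∀ i : Fin N, _ ≤ 176 / β ^ 2 / (N : ℝ) ^ 2 := fun i =>
    resampling_term_le (q := gwRate p (η i) 0) hN1 hα hα1 hκ hβ hβ1 hab (hmean hη) hb1 hρ0 hρ2
      (abs_one_sub_div_sub_one_le hN) (gwRate_nonneg hp.nonneg _ _)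
      (by rw [gwRate_to_zero]; split_ifs; exacts [hp.zero_le_one, zero_le_one])
      (hg1 (η i)) (hha (η i))
  refine (Finset.sum_le_sum (g := fun _ => 176 / β ^ 2 / (N : ℝ) ^ 2)
    fun i _ => le_trans ?_ (hterm i)).trans_eq ?_
  · have hsub : ∀ {φ : ℕ → ℝ}, (∀ y, |φ y| ≤ 1) →
        Summable fun y => fvRate p N η i y * (φ y - φ (η i)) := fun {φ} hφ =>
      summable_fvRate_mul hp hN η i (A := 2) fun y _ =>
        (abs_sub _ _).trans (by linarith [hφ y, hφ (η i)])
    have hupd : (∑' y, fvRate p N η i y *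
          (corrected N α κ (8 / β ^ 2) g h (Function.update η i y)
            - corrected N α κ (8 / β ^ 2) g h η))
        ≤ ((2 * α * (empMean N g η / empMean N h η) + κ) / (empMean N h η * N)
            - 2 * (8 / β ^ 2) * g (η i) / N ^ 2)
              * ∑' y, fvRate p N η i y * (g y - g (η i))
          + (-((2 * α * (empMean N g η / empMean N h η) + κ) * (empMean N g η / empMean N h η))
              / (empMean N h η * N)
            - 2 * (8 / β ^ 2) * h (η i) / N ^ 2)
              * ∑' y, fvRate p N η i y * (h y - h (η i)) := by
      rw [← tsum_mul_left, ← tsum_mul_left,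
        ← ((hsub hg1).mul_left _).tsum_add ((hsub hha).mul_left _)]
      refine Summable.tsum_le_tsum (fun y => ?_) ?_
        (((hsub hg1).mul_left _).add ((hsub hha).mul_left _))
      · by_cases hz : fvRate p N η i y = 0
        · simp [hz]
        · have := mul_le_mul_of_nonneg_left (corrected_update_sub_le hN hα hα1 hκ hβ hgh
            (hmean hη) (hmean (one_le_update_of_fvRate_ne_zero hz hη)))
            (fvRate_nonneg hp.nonneg hN η i y)
          linarith
      · have hc := fun ζ => abs_corrected_le hN hα hα1 hκ
          (by positivity : 0 ≤ 8 / β ^ 2) hgh hh1 (η := ζ)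
        exact summable_fvRate_mul hp hN η i fun y _ =>
          (abs_sub _ _).trans (add_le_add (hc _) (hc _))
    rw [tsum_fvRate_mul hp hN hg0 hg1 hη i, tsum_fvRate_mul hp hN hh0 hha hη i] at hupd
    linarith
  · simp only [Finset.sum_const, Finset.card_univ, Fintype.card_fin, nsmul_eq_mul]
    field_simp

/-- Upper bound for the quadratic observable of the Fleming-Viot system in terms of the
conditioned Galton-Watson expectation. -/
theorem integral_quadratic_le {p : ℕ → ℝ} {σ v : ℝ} (hp : OffspringLaw p σ v)
    (G : GWTransition p) {K₁ : MarkovSemigroup (Fin 1 → ℕ)} (hK₁ : IsFVSemigroup p 1 K₁)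
    {N : ℕ} (hN : 1 ≤ N) {K : MarkovSemigroup (Fin N → ℕ)} (hK : IsFVSemigroup p N K)
    {t : ℝ} (ht : 0 ≤ t) {ξ : Fin N → ℕ} (hξ : ∀ i, 1 ≤ ξ i) {S : Finset ℕ} (hS : 0 ∉ S)
    {f : ℕ → ℝ} (hf : ∀ y, |f y| ≤ 1) (hfS : ∀ y, y ∉ S → f y = 0) {α κ : ℝ} (hα : 0 ≤ α)
    (hα1 : α ≤ 1) (hκ : |κ| ≤ 2) :
    ∫ η, (α * empMean N f η ^ 2 + κ * empMean N f η) ∂K.P t ξ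
      ≤ α * (empMean N (G.expect S f t) ξ / empMean N (G.survival t) ξ) ^ 2
        + κ * (empMean N (G.expect S f t) ξ / empMean N (G.survival t) ξ)
        + 200 * Real.exp (3 * t) / N := by
  have hprob := K.prob t ξ
  have hNpos : (0 : ℝ) < N := by exact_mod_cast hN
  have hg := G.isKilledSolution_expect hp hS hf
  have hh := G.isKilledSolution_survival
  set β := Real.exp (-p 0 * t) with hβdef
  have hβ : 0 < β := Real.exp_pos _
  have hc : 0 ≤ 8 / β ^ 2 := by positivity
  have hgh : ∀ {r : ℝ}, 0 ≤ r → ∀ y, |G.expect S f r y| ≤ G.survival r y :=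
    fun hr y => G.abs_expect_le hS hf hr y
  have hh1 : ∀ {r : ℝ}, 0 ≤ r → ∀ y, G.survival r y ≤ 1 := fun hr y => (G.survival_mem hr y).2
  have hβh : ∀ {r : ℝ}, 0 ≤ r → r ≤ t → ∀ y, 1 ≤ y → β ≤ G.survival r y := by
    intro r hr hrt y hy
    refine le_trans (Real.exp_le_exp.2 ?_) (exp_neg_le_survival hp G hK₁ hr hy)
    nlinarith [hp.nonneg 0]
  have hmean : ∀ {r : ℝ}, 0 ≤ r → r ≤ t → ∀ {η : Fin N → ℕ}, (∀ i, 1 ≤ η i) →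
      empMean N (G.survival r) η ≠ 0 := by
    intro r hr hrt η hη
    refine (hβ.trans_le ?_).ne'
    rw [← empMean_const hN β η]
    exact empMean_mono fun i => hβh hr hrt _ (hη i)
  have key := fv_comparison hp hN hK ht
    (Ψ := fun s => corrected N α κ (8 / β ^ 2) (G.expect S f (t - s)) (G.survival (t - s)))
    (Ψ' := fun s => correctedDeriv N α κ (8 / β ^ 2) (G.expect S f (t - s)) (G.survival (t - s))
      (fun x => -gwBack p (G.expect S f (t - s)) x) (fun x => -gwBack p (G.survival (t - s)) x))
    (A := 3 + 8 / β ^ 2 / N * 2) (B := 176 / β ^ 2 / N) (by positivity)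
    (fun s hs η _ => abs_corrected_le hN hα hα1 hκ hc (hgh (sub_nonneg.2 hs.2))
      (hh1 (sub_nonneg.2 hs.2)) η)
    (fun η hη => continuousOn_corrected (hg.continuousOn_reverse t) (hh.continuousOn_reverse t)
      fun s hs => hmean (sub_nonneg.2 hs.2) (sub_le_self _ hs.1) hη)
    (fun s hs η hη => (hasDerivAt_corrected (hg.hasDerivAt_reverse hs) (hh.hasDerivAt_reverse hs)
      (hmean (sub_nonneg.2 hs.2.le) (sub_le_self _ hs.1) hη)).hasDerivWithinAt)
    (fun s hs η hη => by
      have hr : 0 ≤ t - s := sub_nonneg.2 hs.2.le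
      exact correctedDeriv_add_fvGen_le hp hN hα hα1 hκ hβ (hg.zero _ hr) (hh.zero _ hr)
        (hgh hr) (hh1 hr) (hβh hr (sub_le_self _ hs.1)) hη)
    hξ
  simp only [sub_self, sub_zero] at key
  have hinit := (abs_corrected_sub_le (α := α) (κ := κ) hN hc (hgh ht) (hh1 ht) ξ).1
  have hfbd : ∀ η : Fin N → ℕ, |empMean N f η| ≤ 1 := fun η => by
    rw [← empMean_const hN 1 η]
    exact abs_empMean_le fun i => hf _
  have hmono : ∫ η, (α * empMean N f η ^ 2 + κ * empMean N f η - 8 / β ^ 2 / N * 2) ∂K.P t ξ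
      ≤ ∫ η, (if ∀ i, 1 ≤ η i then
        corrected N α κ (8 / β ^ 2) (G.expect S f 0) (G.survival 0) η else 0) ∂K.P t ξ := by
    refine integral_mono_ae (integrable_of_abs_le (A := 3 + 8 / β ^ 2 / N * 2) fun η => ?_)
      (integrable_of_abs_le (A := 3 + 8 / β ^ 2 / N * 2) fun η => ?_) ?_
    · have h1 := abs_le.1 (hfbd η)
      have h2 : |κ * empMean N f η| ≤ 2 * 1 := by
        rw [abs_mul]
        exact mul_le_mul hκ (hfbd η) (abs_nonneg _) (by norm_num)
      have h3 : α * empMean N f η ^ 2 ≤ 1 :=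
        mul_le_one₀ hα1 (sq_nonneg _) ((sq_le_one_iff_abs_le_one _).2 (hfbd η))
      have h4 : 0 ≤ α * empMean N f η ^ 2 := by positivity
      have h5 := abs_le.1 h2
      have h6 : 0 ≤ 8 / β ^ 2 / N * 2 := by positivity
      rw [abs_le]
      constructor <;> linarith
    · split_ifs
      · exact abs_corrected_le hN hα hα1 hκ hc (hgh le_rfl) (hh1 le_rfl) η
      · simp only [abs_zero]
        positivity
    · filter_upwards [ae_one_le hp hN hK ht hξ] with η hη
      have hlast := (abs_corrected_sub_le (α := α) (κ := κ) hN hc (hgh le_rfl) (hh1 le_rfl) η).2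
      have e1 : empMean N (G.expect S f 0) η = empMean N f η := by
        simp only [empMean, G.expect_zero S hfS]
      have e2 : empMean N (G.survival 0) η = 1 := by
        rw [← empMean_const hN 1 η]
        simp only [empMean, G.survival_zero (hη _)]
      rw [e1, e2, div_one] at hlast
      rw [if_pos hη]
      linarith
  rw [integral_sub (integrable_of_abs_le (A := 3) fun η => by
      have h2 : |κ * empMean N f η| ≤ 2 * 1 := by
        rw [abs_mul]
        exact mul_le_mul hκ (hfbd η) (abs_nonneg _) (by norm_num)
      have h3 : |α * empMean N f η ^ 2| ≤ 1 := by
        rw [abs_of_nonneg (by positivity)]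
        exact mul_le_one₀ hα1 (sq_nonneg _) ((sq_le_one_iff_abs_le_one _).2 (hfbd η))
      exact (abs_add_le _ _).trans (by linarith)) (integrable_const _),
    integral_const, probReal_univ, one_smul] at hmono
  have hconst : 8 / β ^ 2 / N * 2 + 176 / β ^ 2 / N * t ≤ 200 * Real.exp (3 * t) / N := by
    have h1 : (β ^ 2)⁻¹ ≤ Real.exp (2 * t) := by
      rw [hβdef, ← Real.exp_nat_mul, ← Real.exp_neg]
      refine Real.exp_le_exp.2 ?_
      push_cast
      nlinarith [hp.zero_le_one]
    have h2 : 16 + 176 * t ≤ 200 * Real.exp t := by linarith [Real.add_one_le_exp t]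
    have h3 : Real.exp (3 * t) = Real.exp t * Real.exp (2 * t) := by
      rw [← Real.exp_add]
      ring_nf
    rw [h3, ← mul_assoc]
    calc _ = (16 + 176 * t) * (β ^ 2)⁻¹ / N := by
          simp only [div_eq_mul_inv]
          ring
      _ ≤ _ := div_le_div_of_nonneg_right
          (mul_le_mul h2 h1 (by positivity) (by positivity)) hNpos.le
  linarith

theorem integrable_emp {N : ℕ} (hN : 1 ≤ N) {μ : Measure (Fin N → ℕ)} [IsProbabilityMeasure μ]
    (x : ℕ) : Integrable (fun η => emp N x η) μ := by
  refine integrable_of_abs_le (A := 1) fun η => ?_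
  rw [← empMean_const hN 1 η]
  exact abs_empMean_le (φ := fun z => if z = x then (1 : ℝ) else 0) fun i => by
    split_ifs <;> simp

theorem empMean_eq_sum {N : ℕ} {S : Finset ℕ} {f : ℕ → ℝ} (hfS : ∀ y, y ∉ S → f y = 0)
    (η : Fin N → ℕ) : empMean N f η = ∑ y ∈ S, f y * emp N y η := by
  rw [← (hasSum_emp_mul N f η).tsum_eq, tsum_eq_sum (s := S) fun y hy => by simp [hfS y hy]]
  exact Finset.sum_congr rfl fun y _ => mul_comm _ _

namespace GWTransition

theorem condLaw_eq {p : ℕ → ℝ} (G : GWTransition p) {N : ℕ} {t : ℝ} (ht : 0 ≤ t)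
    (ξ : Fin N → ℕ) (y : ℕ) :
    condLaw G.pt (fun x => emp N x ξ) t y
      = empMean N (fun x => G.pt t x y) ξ / empMean N (G.survival t) ξ := by
  unfold condLaw
  rw [(hasSum_emp_mul N (fun x => G.pt t x y) ξ).tsum_eq]
  congr 1
  rw [← (hasSum_emp_mul N (G.survival t) ξ).tsum_eq]
  refine tsum_congr fun x => ?_
  rw [← (G.hasSum_survival ht x).tsum_eq, ← tsum_mul_left]
  exact tsum_congr fun z => by split_ifs <;> simp

theorem expect_ratio_eq {p : ℕ → ℝ} (G : GWTransition p) {N : ℕ} {t : ℝ} (ht : 0 ≤ t)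
    (ξ : Fin N → ℕ) (S : Finset ℕ) (f : ℕ → ℝ) :
    empMean N (G.expect S f t) ξ / empMean N (G.survival t) ξ
      = ∑ y ∈ S, f y * condLaw G.pt (fun x => emp N x ξ) t y := by
  simp only [G.condLaw_eq ht, ← mul_div_assoc, ← Finset.sum_div]
  congr 1
  simp only [empMean, expect, Finset.mul_sum]
  rw [Finset.sum_comm]
  exact Finset.sum_congr rfl fun y _ => Finset.sum_congr rfl fun i _ => by ring

end GWTransition

/-- Weighted differences between the mean empirical measure and the conditioned law. -/
theorem abs_sum_mul_sub_condLaw_le {p : ℕ → ℝ} {σ v : ℝ} (hp : OffspringLaw p σ v)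
    (G : GWTransition p) {K₁ : MarkovSemigroup (Fin 1 → ℕ)} (hK₁ : IsFVSemigroup p 1 K₁)
    {N : ℕ} (hN : 1 ≤ N) {K : MarkovSemigroup (Fin N → ℕ)} (hK : IsFVSemigroup p N K)
    {t : ℝ} (ht : 0 ≤ t) {ξ : Fin N → ℕ} (hξ : ∀ i, 1 ≤ ξ i) {S : Finset ℕ} (hS : 0 ∉ S)
    {f : ℕ → ℝ} (hf : ∀ y ∈ S, |f y| ≤ 1) :
    |∑ y ∈ S, f y * ((∫ η, emp N y η ∂K.P t ξ) - condLaw G.pt (fun x => emp N x ξ) t y)|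
      ≤ 200 * Real.exp (3 * t) / N := by
  have hprob := K.prob t ξ
  set f' : ℕ → ℝ := fun y => if y ∈ S then f y else 0 with hf'
  have hf1 : ∀ y, |f' y| ≤ 1 := fun y => by
    simp only [hf']
    split_ifs with hy
    · exact hf y hy
    · simp
  have hfS : ∀ y, y ∉ S → f' y = 0 := fun y hy => if_neg hy
  have hmean : ∫ η, empMean N f' η ∂K.P t ξ = ∑ y ∈ S, f' y * ∫ η, emp N y η ∂K.P t ξ := by
    simp only [empMean_eq_sum hfS]
    rw [integral_finsetSum _ fun y _ => (integrable_emp hN y).const_mul _]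
    simp only [integral_const_mul]
  have hsum : ∑ y ∈ S, f y * ((∫ η, emp N y η ∂K.P t ξ) - condLaw G.pt (fun x => emp N x ξ) t y)
      = ∫ η, empMean N f' η ∂K.P t ξ
        - empMean N (G.expect S f' t) ξ / empMean N (G.survival t) ξ := by
    rw [hmean, G.expect_ratio_eq ht, ← Finset.sum_sub_distrib]
    exact Finset.sum_congr rfl fun y hy => by simp only [hf', if_pos hy]; ring
  have key : ∀ κ : ℝ, |κ| ≤ 2 → κ * ∫ η, empMean N f' η ∂K.P t ξ
      ≤ κ * (empMean N (G.expect S f' t) ξ / empMean N (G.survival t) ξ)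
        + 200 * Real.exp (3 * t) / N := fun κ hκ => by
    simpa [integral_const_mul] using
      integral_quadratic_le hp G hK₁ hN hK ht hξ hS hf1 hfS le_rfl zero_le_one hκ
  have h1 := key 1 (by norm_num)
  have h2 := key (-1) (by norm_num)
  rw [hsum, abs_le]
  constructor <;> linarith

theorem abs_sub_condLaw_le {p : ℕ → ℝ} {σ v : ℝ} (hp : OffspringLaw p σ v)
    (G : GWTransition p) {K₁ : MarkovSemigroup (Fin 1 → ℕ)} (hK₁ : IsFVSemigroup p 1 K₁)
    {N : ℕ} (hN : 1 ≤ N) {K : MarkovSemigroup (Fin N → ℕ)} (hK : IsFVSemigroup p N K)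
    {t : ℝ} (ht : 0 ≤ t) {ξ : Fin N → ℕ} (hξ : ∀ i, 1 ≤ ξ i) {x : ℕ} (hx : 1 ≤ x) :
    |(∫ η, emp N x η ∂K.P t ξ) - condLaw G.pt (fun y => emp N y ξ) t x|
      ≤ 200 * Real.exp (3 * t) / N := by
  simpa using abs_sum_mul_sub_condLaw_le hp G hK₁ hN hK ht hξ (S := {x})
    (by simp; omega) (f := fun _ => 1) (by simp)

theorem tsum_sq_sub_condLaw_le {p : ℕ → ℝ} {σ v : ℝ} (hp : OffspringLaw p σ v)
    (G : GWTransition p) {K₁ : MarkovSemigroup (Fin 1 → ℕ)} (hK₁ : IsFVSemigroup p 1 K₁)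
    {N : ℕ} (hN : 1 ≤ N) {K : MarkovSemigroup (Fin N → ℕ)} (hK : IsFVSemigroup p N K)
    {t : ℝ} (ht : 0 ≤ t) {ξ : Fin N → ℕ} (hξ : ∀ i, 1 ≤ ξ i) :
    (∑' x : ℕ, (if 1 ≤ x then
        ((∫ η, emp N x η ∂K.P t ξ) - condLaw G.pt (fun y => emp N y ξ) t x) ^ 2 else 0))
      ≤ (200 * Real.exp (3 * t) / N) ^ 2 := by
  have hNpos : (0 : ℝ) < N := by exact_mod_cast hN
  have hpt := fun x => abs_sub_condLaw_le hp G hK₁ hN hK ht hξ (x := x)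
  have hB : 0 < 200 * Real.exp (3 * t) / (N : ℝ) := by positivity
  set D : ℕ → ℝ := fun x =>
    (∫ η, emp N x η ∂K.P t ξ) - condLaw G.pt (fun y => emp N y ξ) t x with hD
  refine Real.tsum_le_of_sum_le (fun x => by positivity) fun S => ?_
  rw [← Finset.sum_filter]
  have key := abs_sum_mul_sub_condLaw_le hp G hK₁ hN hK ht hξ (S := S.filter (1 ≤ ·))
    (by simp) (f := fun y => (200 * Real.exp (3 * t) / (N : ℝ))⁻¹ * D y) (fun y hy => by
      rw [abs_mul, abs_of_pos (inv_pos.2 hB), inv_mul_le_one₀ hB]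
      exact hpt y (Finset.mem_filter.1 hy).2)
  have e : ∑ y ∈ S.filter (1 ≤ ·), (200 * Real.exp (3 * t) / (N : ℝ))⁻¹ * D y * D y
      = (200 * Real.exp (3 * t) / (N : ℝ))⁻¹ * ∑ y ∈ S.filter (1 ≤ ·), D y ^ 2 := by
    rw [Finset.mul_sum]
    exact Finset.sum_congr rfl fun y _ => by ring
  have key' := (le_abs_self _).trans key
  rw [e, inv_mul_le_iff₀ hB, ← sq] at key'
  exact key'

theorem integral_sq_sub_condLaw_le {p : ℕ → ℝ} {σ v : ℝ} (hp : OffspringLaw p σ v)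
    (G : GWTransition p) {K₁ : MarkovSemigroup (Fin 1 → ℕ)} (hK₁ : IsFVSemigroup p 1 K₁)
    {N : ℕ} (hN : 1 ≤ N) {K : MarkovSemigroup (Fin N → ℕ)} (hK : IsFVSemigroup p N K)
    {t : ℝ} (ht : 0 ≤ t) {ξ : Fin N → ℕ} (hξ : ∀ i, 1 ≤ ξ i) {x : ℕ} (hx : 1 ≤ x) :
    ∫ η, (emp N x η - condLaw G.pt (fun y => emp N y ξ) t x) ^ 2 ∂K.P t ξ
      ≤ 200 * Real.exp (3 * t) / N := by
  have hprob := K.prob t ξ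
  set f : ℕ → ℝ := fun z => if z = x then 1 else 0 with hf
  have hf1 : ∀ y, |f y| ≤ 1 := fun y => by
    simp only [hf]
    split_ifs <;> simp
  have hfS : ∀ y, y ∉ ({x} : Finset ℕ) → f y = 0 := fun y hy => if_neg (by simpa using hy)
  have hS : (0 : ℕ) ∉ ({x} : Finset ℕ) := by simp; omega
  have hF : empMean N (G.expect {x} f t) ξ / empMean N (G.survival t) ξ
      = condLaw G.pt (fun y => emp N y ξ) t x := by
    rw [G.expect_ratio_eq ht]
    simp [hf]
  have hF1 : |condLaw G.pt (fun y => emp N y ξ) t x| ≤ 1 := by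
    rw [← hF]
    exact abs_empMean_div_le_one (G.abs_expect_le hS hf1 ht)
  set F := condLaw G.pt (fun y => emp N y ξ) t x
  have key := integral_quadratic_le hp G hK₁ hN hK ht hξ hS hf1 hfS zero_le_one le_rfl
    (κ := -2 * F) (by rw [abs_mul]; norm_num; linarith)
  rw [hF] at key
  have he : ∀ η, (emp N x η - F) ^ 2 = (1 * empMean N f η ^ 2 + -2 * F * empMean N f η) + F ^ 2 :=
    fun η => by
      have : empMean N f η = emp N x η := rfl
      rw [this]
      ring
  simp only [he]
  rw [integral_add (integrable_of_abs_le (A := 3) fun η => ?_) (integrable_const _),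
    integral_const, probReal_univ, one_smul]
  · linarith
  · have hb : |empMean N f η| ≤ 1 := by
      rw [← empMean_const hN 1 η]
      exact abs_empMean_le fun i => hf1 _
    have h1 : |F * empMean N f η| ≤ 1 := by
      rw [abs_mul]
      exact mul_le_one₀ hF1 (abs_nonneg _) hb
    have h2 := (sq_le_one_iff_abs_le_one _).2 hb
    have h3 := abs_le.1 h1
    rw [abs_le]
    constructor <;> nlinarith [sq_nonneg (empMean N f η)]

/-- **Closeness of the Fleming-Viot mean empirical measure and the conditioned
semigroup.** There are constants `c, C > 0` such that, uniformly in the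
initial configuration `ξ`:
(i) `‖E[m(·,ξ_t)] - m(·,ξ)T_t‖ ≤ C e^{ct}/N` in `ℓ²`, hence pointwise; and
(ii) `E[(m(x,ξ_t) - m(·,ξ)T_t(x))²] ≤ C e^{ct}/N` for every site `x`. -/
theorem fv_semigroup_closeness
    (p : ℕ → ℝ) (σ v : ℝ) (hp : OffspringLaw p σ v)
    (G : GWTransition p)
    (K : ∀ N : ℕ, MarkovSemigroup (Fin N → ℕ))
    (hK : ∀ N : ℕ, 1 ≤ N → IsFVSemigroup p N (K N)) :
    ∃ c C : ℝ, 0 < c ∧ 0 < C ∧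
      ∀ N : ℕ, 1 ≤ N → ∀ t : ℝ, 0 ≤ t → ∀ ξ : Fin N → ℕ, (∀ i, 1 ≤ ξ i) →
        ((∑' x : ℕ, (if 1 ≤ x then
            ((∫ η, emp N x η ∂ (K N).P t ξ)
              - condLaw G.pt (fun y => emp N y ξ) t x) ^ 2 else 0))
          ≤ (C * Real.exp (c * t) / N) ^ 2) ∧
        (∀ x : ℕ, 1 ≤ x →
          |(∫ η, emp N x η ∂ (K N).P t ξ)
              - condLaw G.pt (fun y => emp N y ξ) t x|
            ≤ C * Real.exp (c * t) / N) ∧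
        (∀ x : ℕ, 1 ≤ x →
          (∫ η, (emp N x η - condLaw G.pt (fun y => emp N y ξ) t x) ^ 2
              ∂ (K N).P t ξ)
            ≤ C * Real.exp (c * t) / N) := by
  refine ⟨3, 200, by norm_num, by norm_num, fun N hN t ht ξ hξ =>
    ⟨?_, fun x hx => ?_, fun x hx => ?_⟩⟩
  · exact tsum_sq_sub_condLaw_le hp G (hK 1 le_rfl) hN (hK N hN) ht hξ
  · exact abs_sub_condLaw_le hp G (hK 1 le_rfl) hN (hK N hN) ht hξ hx
  · exact integral_sq_sub_condLaw_le hp G (hK 1 le_rfl) hN (hK N hN) ht hξ hx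

end
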